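/- arXiv:1010.1394 — 2 statements merged into one kernel-verified Lean document; each statement's English description precedes it below -/
import Mathlib

section
/- Let d ≥ 1, 0 < α ≤ 1/2 and 0 < η ≤ 1. If μ is a mean (α,η)-porous Borel probability measure on ℝ^d, then dim_P(μ) ≤ d − c_d·η·α^d, where c_d = 2/(5·log 2·2^{4d}·d^{d/2}). -/
open MeasureTheory Filter Metric Set
open scoped ENNReal NNReal

/-- The porosity `por(μ,x,r,ε)`: the supremum of all `α ≥ 0` such that there is `y` with
`B(y,αr) ⊆ B(x,r)` and `μ(B(y,αr)) ≤ ε·μ(B(x,r))` (closed balls). -/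
noncomputable def por {d : ℕ} (μ : Measure (EuclideanSpace ℝ (Fin d)))
    (x : EuclideanSpace ℝ (Fin d)) (r ε : ℝ) : ℝ :=
  sSup {α : ℝ | 0 ≤ α ∧ ∃ y, Metric.closedBall y (α * r) ⊆ Metric.closedBall x r ∧
    μ (Metric.closedBall y (α * r)) ≤ ENNReal.ofReal ε * μ (Metric.closedBall x r)}

/-- `μ` is mean `(α,η,ε)`-porous: for `μ`-a.e. `x`,
`liminf_n (1/n)·#{i < n : por(μ,x,2^{-i},ε) ≥ α} ≥ η`. -/
def MeanPorousWith {d : ℕ} (μ : Measure (EuclideanSpace ℝ (Fin d))) (α η ε : ℝ) : Prop :=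
  ∀ᵐ x ∂μ, η ≤ Filter.liminf
    (fun n : ℕ =>
      (Set.ncard {i : ℕ | i < n ∧ α ≤ por μ x ((2 : ℝ) ^ (-(i : ℝ))) ε} : ℝ) / n)
    Filter.atTop

/-- `μ` is mean `(α,η)`-porous: it is mean `(α,η,ε)`-porous for all `ε > 0`. -/
def MeanPorous {d : ℕ} (μ : Measure (EuclideanSpace ℝ (Fin d))) (α η : ℝ) : Prop :=
  ∀ ε > 0, MeanPorousWith μ α η ε

/-- The upper local dimension of a measure at a point:
`limsup_{r→0⁺} log μ(B(x,r)) / log r` (closed balls), as an extended real. -/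
noncomputable def upperLocalDim {d : ℕ} (μ : Measure (EuclideanSpace ℝ (Fin d)))
    (x : EuclideanSpace ℝ (Fin d)) : EReal :=
  Filter.limsup
    (fun r : ℝ => ((Real.log ((μ (Metric.closedBall x r)).toReal) / Real.log r : ℝ) : EReal))
    (nhdsWithin (0 : ℝ) (Set.Ioi 0))

/-- The (upper) packing dimension of a measure: the `μ`-essential supremum of the
upper local dimensions. -/
noncomputable def packingDim {d : ℕ} (μ : Measure (EuclideanSpace ℝ (Fin d))) : EReal :=
  essSup (fun x => upperLocalDim μ x) μ

theorem ae_of_forall_ae_restrict_cell {X ι : Type*} [MeasurableSpace X] [Countable ι]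
    {c : X → ι} {ν : Measure X} {p : X → Prop}
    (h : ∀ x₀, ∀ᵐ x ∂ν.restrict (c ⁻¹' {c x₀}), p x) : ∀ᵐ x ∂ν, p x := by
  have hU : (univ : Set X) = ⋃ i : ι, c ⁻¹' {i} := by ext; simp
  rw [← Measure.restrict_univ (μ := ν), hU, ae_restrict_iUnion_iff]
  intro i
  by_cases hi : ∃ x, c x = i
  · obtain ⟨x, hx⟩ := hi
    rw [← hx]
    exact h x
  · have : c ⁻¹' {(i : ι)} = ∅ := by
      ext x
      simpa using fun hx => hi ⟨x, hx⟩
    simp [this]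

theorem cell_eq_of_le {X ι : Type*} {c : ℕ → X → ι}
    (hr : ∀ n x y, c (n + 1) x = c (n + 1) y → c n x = c n y)
    {m n : ℕ} (hmn : m ≤ n) {x y : X} (h : c n x = c n y) : c m x = c m y := by
  induction n, hmn using Nat.le_induction with
  | base => exact h
  | succ n _ ih => exact ih (hr n x y h)

theorem cell_eq_preimage {X ι : Type*} {c : ℕ → X → ι}
    (hr : ∀ n x y, c (n + 1) x = c (n + 1) y → c n x = c n y) (l : ℕ) (x : X) :
    c l ⁻¹' {c l x} = c (l + 1) ⁻¹' (c (l + 1) '' (c l ⁻¹' {c l x})) := by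
  refine subset_antisymm (subset_preimage_image _ _) ?_
  rintro z ⟨w, hw, hwz⟩
  exact (hr l w z hwz).symm.trans hw

open Classical in
/-- Indicator of the event that the cell of level `i` belongs to `P i` and `x` is in its hole. -/
noncomputable def holeHit {X ι : Type*} (c : ℕ → X → ι) (P : ℕ → Set ι) (H : ℕ → ι → ι) (m : ℕ)
    (i : ℕ) (x : X) : ℝ :=
  if c i x ∈ P i ∧ c (i + m) x = H i (c i x) then 1 else 0

theorem holeHit_eq_of_cell_eq {X ι : Type*} {c : ℕ → X → ι}
    (hr : ∀ n x y, c (n + 1) x = c (n + 1) y → c n x = c n y) {P : ℕ → Set ι} {H : ℕ → ι → ι}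
    {m i : ℕ} {x y : X} (h : c (i + m) x = c (i + m) y) :
    holeHit c P H m i x = holeHit c P H m i y := by
  rw [holeHit, holeHit, h, cell_eq_of_le hr (Nat.le_add_right i m) h]

section Cells

variable {X ι : Type*} [MeasurableSpace X] [MeasurableSpace ι] [MeasurableSingletonClass ι]
  [Countable ι]

theorem setLIntegral_preimage_le {c : X → ι} (hc : Measurable c) {ν₁ ν₂ : Measure X}
    {F G : X → ℝ≥0∞} (T : Set ι)
    (h : ∀ x, c x ∈ T → ∫⁻ z in c ⁻¹' {c x}, F z ∂ν₁ ≤ ∫⁻ z in c ⁻¹' {c x}, G z ∂ν₂) :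
    ∫⁻ z in c ⁻¹' T, F z ∂ν₁ ≤ ∫⁻ z in c ⁻¹' T, G z ∂ν₂ := by
  have hT : c ⁻¹' T = ⋃ i : T, c ⁻¹' {(i : ι)} := by ext; simp
  have hd : Pairwise (Function.onFun Disjoint fun i : T => c ⁻¹' {(i : ι)}) := by
    intro i j hij
    refine Disjoint.preimage _ ?_
    simpa [Subtype.ext_iff] using fun h => hij (Subtype.ext h)
  rw [hT, lintegral_iUnion (fun i => hc (measurableSet_singleton _)) hd,
    lintegral_iUnion (fun i => hc (measurableSet_singleton _)) hd]
  refine ENNReal.tsum_le_tsum fun i => ?_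
  by_cases hi : ∃ x, c x = i
  · obtain ⟨x, hx⟩ := hi
    rw [← hx]
    exact h x (hx ▸ i.2)
  · have : c ⁻¹' {(i : ι)} = ∅ := by
      ext x
      simpa using fun hx => hi ⟨x, hx⟩
    simp [this]

theorem measurable_of_const_on_cells {c : X → ι} (hc : Measurable c) {β : Type*} [Nonempty β]
    [MeasurableSpace β] {F : X → β} (hF : ∀ x y, c x = c y → F x = F y) : Measurable F := by
  obtain ⟨e, rfl⟩ := (Function.factorsThrough_iff (g := F) (f := c)).1 (fun x y h => hF x y h)
  exact (Measurable.of_discrete (f := e)).comp hc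

theorem ae_eventually_le_exp {ν : Measure X} {F : ℕ → X → ℝ≥0∞} (hF : ∀ n, Measurable (F n))
    {C : ℝ≥0∞} (hC : C ≠ ∞) (h : ∀ n, ∫⁻ x, F n x ∂ν ≤ C) {ξ : ℝ} (hξ : 0 < ξ) :
    ∀ᵐ x ∂ν, ∀ᶠ n : ℕ in atTop, F n x ≤ ENNReal.ofReal (Real.exp (ξ * n)) := by
  set ρ : ℝ≥0∞ := ENNReal.ofReal (Real.exp (-ξ)) with hρ
  have hρ1 : ρ < 1 := by
    rw [hρ, ← ENNReal.ofReal_one]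
    exact (ENNReal.ofReal_lt_ofReal_iff one_pos).2 (by simpa using hξ)
  have hpow (n : ℕ) : ρ ^ n * ENNReal.ofReal (Real.exp (ξ * n)) = 1 := by
    rw [hρ, ← ENNReal.ofReal_pow (Real.exp_nonneg _), ← Real.exp_nat_mul,
      ← ENNReal.ofReal_mul (Real.exp_nonneg _), ← Real.exp_add]
    simp [mul_comm]
  have hmeas (n : ℕ) : Measurable fun x => ρ ^ n * F n x := (hF n).const_mul _
  have hFint : ∫⁻ x, ∑' n, ρ ^ n * F n x ∂ν ≠ ∞ := by
    rw [lintegral_tsum fun n => (hmeas n).aemeasurable]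
    have hle : ∑' n, ∫⁻ x, ρ ^ n * F n x ∂ν ≤ ∑' n, ρ ^ n * C := by
      refine ENNReal.tsum_le_tsum fun n => ?_
      rw [lintegral_const_mul _ (hF n)]
      gcongr
      exact h n
    refine ne_top_of_le_ne_top ?_ hle
    rw [ENNReal.tsum_mul_right, ENNReal.tsum_geometric]
    refine ENNReal.mul_ne_top ?_ hC
    simpa [tsub_eq_zero_iff_le] using hρ1
  have hae := ae_lt_top (Measurable.tsum hmeas) hFint
  filter_upwards [hae] with x hx
  have ht := ENNReal.tendsto_atTop_zero_of_tsum_ne_top hx.ne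
  filter_upwards [ht.eventually (gt_mem_nhds one_pos)] with n hn
  have := hpow n
  calc F n x = (ρ ^ n * F n x) * ENNReal.ofReal (Real.exp (ξ * n)) := by
        rw [mul_right_comm, this, one_mul]
    _ ≤ 1 * ENNReal.ofReal (Real.exp (ξ * n)) := by gcongr
    _ = _ := one_mul _

theorem ofReal_exp_sum (u : ℕ → ℝ) (s : Finset ℕ) :
    ENNReal.ofReal (Real.exp (∑ j ∈ s, u j)) = ∏ j ∈ s, ENNReal.ofReal (Real.exp (u j)) := by
  rw [Real.exp_sum, ENNReal.ofReal_prod_of_nonneg fun _ _ => Real.exp_nonneg _]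

/-- A strong law: sums of increments with conditional exponential moment at most one grow
sublinearly from above. -/
theorem ae_eventually_sum_le {c : ℕ → X → ι} (hc : ∀ n, Measurable (c n))
    (hr : ∀ n x y, c (n + 1) x = c (n + 1) y → c n x = c n y) {ν : Measure X}
    (hν : ∀ x, ν (c 0 ⁻¹' {c 0 x}) ≠ ∞) {u : ℕ → X → ℝ}
    (hu : ∀ j x y, c (j + 1) x = c (j + 1) y → u j x = u j y)
    (hle : ∀ j x, ∫⁻ z in c j ⁻¹' {c j x}, ENNReal.ofReal (Real.exp (u j z)) ∂ν
      ≤ ν (c j ⁻¹' {c j x})) {ξ : ℝ} (hξ : 0 < ξ) :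
    ∀ᵐ x ∂ν, ∀ᶠ L : ℕ in atTop, ∑ j ∈ Finset.range L, u j x ≤ ξ * L := by
  have hconst (L : ℕ) (x y : X) (h : c L x = c L y) :
      ENNReal.ofReal (Real.exp (∑ j ∈ Finset.range L, u j x)) =
      ENNReal.ofReal (Real.exp (∑ j ∈ Finset.range L, u j y)) := by
    rw [Finset.sum_congr rfl fun j hj =>
      hu j x y (cell_eq_of_le hr (Nat.succ_le_of_lt (Finset.mem_range.1 hj)) h)]
  have key (x₀ : X) (L : ℕ) : ∫⁻ z in c 0 ⁻¹' {c 0 x₀},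
      ENNReal.ofReal (Real.exp (∑ j ∈ Finset.range L, u j z)) ∂ν ≤ ν (c 0 ⁻¹' {c 0 x₀}) := by
    induction L with
    | zero => simp
    | succ L ih =>
      refine le_trans ?_ ih
      have hS : c 0 ⁻¹' {c 0 x₀} = c L ⁻¹' (c L '' (c 0 ⁻¹' {c 0 x₀})) := by
        refine subset_antisymm (subset_preimage_image _ _) ?_
        rintro z ⟨w, hw, hwz⟩
        exact (cell_eq_of_le hr (Nat.zero_le L) hwz).symm.trans hw
      rw [hS]
      refine setLIntegral_preimage_le (hc L) _ fun x _ => ?_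
      have hm : MeasurableSet (c L ⁻¹' {c L x}) := hc L (measurableSet_singleton _)
      have h1 : ∫⁻ z in c L ⁻¹' {c L x},
          ENNReal.ofReal (Real.exp (∑ j ∈ Finset.range (L + 1), u j z)) ∂ν =
          ∫⁻ z in c L ⁻¹' {c L x}, ENNReal.ofReal (Real.exp (∑ j ∈ Finset.range L, u j x)) *
            ENNReal.ofReal (Real.exp (u L z)) ∂ν := by
        refine setLIntegral_congr_fun hm fun z hz => ?_
        rw [hconst L x z (Eq.symm hz), Finset.sum_range_succ, Real.exp_add,
          ENNReal.ofReal_mul (Real.exp_nonneg _)]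
      have h2 : ∫⁻ z in c L ⁻¹' {c L x},
          ENNReal.ofReal (Real.exp (∑ j ∈ Finset.range L, u j z)) ∂ν =
          ENNReal.ofReal (Real.exp (∑ j ∈ Finset.range L, u j x)) * ν (c L ⁻¹' {c L x}) := by
        rw [← setLIntegral_const]
        exact setLIntegral_congr_fun hm fun z hz => hconst L z x hz
      rw [h1, h2, lintegral_const_mul' _ _ ENNReal.ofReal_ne_top]
      gcongr
      exact hle L x
  refine ae_of_forall_ae_restrict_cell (c := c 0) fun x₀ => ?_
  filter_upwards [ae_eventually_le_exp
    (fun L => measurable_of_const_on_cells (hc L) (hconst L)) (hν x₀) (key x₀) hξ] with x hx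
  filter_upwards [hx] with L hL
  rwa [ENNReal.ofReal_le_ofReal_iff (Real.exp_nonneg _), Real.exp_le_exp] at hL

open Classical in
theorem setLIntegral_hole_step {c : ℕ → X → ι} (hc : ∀ n, Measurable (c n))
    (hr : ∀ n x y, c (n + 1) x = c (n + 1) y → c n x = c n y) {ν : Measure X} {p q δ b : ℝ≥0∞}
    (hq : ∀ n x, ν (c (n + 1) ⁻¹' {c (n + 1) x}) = q * ν (c n ⁻¹' {c n x}))
    (hp : ∀ n x, ν (c n ⁻¹' {c n x} \ c (n + 1) ⁻¹' {c (n + 1) x}) = p * ν (c n ⁻¹' {c n x}))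
    (hδ : δ ≤ 1) {l n : ℕ} {Ψ : X → ℝ≥0∞} (y : X)
    (hΨ : ∀ x, ∫⁻ z in c (l + 1) ⁻¹' {c (l + 1) x}, Ψ z ∂ν ≤ ν (c (l + 1) ⁻¹' {c (l + 1) x}))
    (hy : ∫⁻ z in c (l + 1) ⁻¹' {c (l + 1) y}, (if c n z = c n y then δ else 1) * Ψ z ∂ν
      ≤ b * ν (c (l + 1) ⁻¹' {c (l + 1) y})) :
    ∫⁻ z in c l ⁻¹' {c l y}, (if c n z = c n y then δ else 1) * Ψ z ∂ν
      ≤ (q * b + p) * ν (c l ⁻¹' {c l y}) := by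
  have hsub : c (l + 1) ⁻¹' {c (l + 1) y} ⊆ c l ⁻¹' {c l y} := fun z hz => hr l z y hz
  rw [← union_sdiff_cancel hsub]
  refine (lintegral_union_le _ _ _).trans ?_
  rw [union_sdiff_cancel hsub, add_mul, ← hp l y, mul_right_comm, ← hq l y, mul_comm _ b]
  refine add_le_add hy ?_
  have hdiff : c l ⁻¹' {c l y} \ c (l + 1) ⁻¹' {c (l + 1) y} =
      c (l + 1) ⁻¹' ((c (l + 1) '' (c l ⁻¹' {c l y})) \ {c (l + 1) y}) := by
    rw [preimage_sdiff, ← cell_eq_preimage hr]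
  calc ∫⁻ z in c l ⁻¹' {c l y} \ c (l + 1) ⁻¹' {c (l + 1) y},
        (if c n z = c n y then δ else 1) * Ψ z ∂ν
      ≤ ∫⁻ z in c l ⁻¹' {c l y} \ c (l + 1) ⁻¹' {c (l + 1) y}, Ψ z ∂ν := by
        refine lintegral_mono fun z => ?_
        refine (mul_le_mul_left ?_ _).trans (one_mul _).le
        split_ifs <;> simp [hδ]
    _ ≤ ∫⁻ z in c l ⁻¹' {c l y} \ c (l + 1) ⁻¹' {c (l + 1) y}, 1 ∂ν := by
        rw [hdiff]
        refine setLIntegral_preimage_le (hc _) _ fun x _ => ?_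
        rw [setLIntegral_one]
        exact hΨ x
    _ = _ := setLIntegral_one _

open Classical in
/-- The factor contributed by the partition of level `i`: cells in `P i` gain a factor `G`
outside of their hole, and `G * δ` in the hole. -/
noncomputable def holeWeight (c : ℕ → X → ι) (P : ℕ → Set ι) (H : ℕ → ι → ι) (m : ℕ)
    (G δ : ℝ≥0∞) (i : ℕ) (x : X) : ℝ≥0∞ :=
  if c i x ∈ P i then G * (if c (i + m) x = H i (c i x) then δ else 1) else 1

theorem setLIntegral_prod_holeWeight_le {c : ℕ → X → ι} (hc : ∀ n, Measurable (c n))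
    (hr : ∀ n x y, c (n + 1) x = c (n + 1) y → c n x = c n y) {ν : Measure X}
    {p q δ G : ℝ≥0∞}
    (hq : ∀ n x, ν (c (n + 1) ⁻¹' {c (n + 1) x}) = q * ν (c n ⁻¹' {c n x}))
    (hp : ∀ n x, ν (c n ⁻¹' {c n x} \ c (n + 1) ⁻¹' {c (n + 1) x}) = p * ν (c n ⁻¹' {c n x}))
    (hδ : δ ≤ 1) (hδ' : δ ≠ ∞) (hG : 1 ≤ G) (hG' : G ≠ ∞) {m : ℕ} {B : ℕ → ℝ≥0∞}
    (hB0 : B 0 = δ)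
    (hB : ∀ k, B (k + 1) = G * (q * B k + p)) (hBm : B (m + 1) ≤ 1) {P : ℕ → Set ι}
    {H : ℕ → ι → ι}
    (hH : ∀ i x, c i x ∈ P i → ∃ y, c i y = c i x ∧ c (i + (m + 1)) y = H i (c i x))
    (N k l : ℕ) (hl : N ≤ l + k) (x : X) :
    ∫⁻ z in c l ⁻¹' {c l x}, ∏ i ∈ Finset.Ico l N, holeWeight c P H (m + 1) G δ i z ∂ν
      ≤ ν (c l ⁻¹' {c l x}) := by
  classical
  have hwG (i : ℕ) (z : X) : holeWeight c P H (m + 1) G δ i z ≤ G := by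
    unfold holeWeight
    split_ifs
    · exact (mul_le_mul_right hδ _).trans (mul_one _).le
    · simp
    · exact hG
  induction k generalizing l x with
  | zero =>
    rw [Finset.Ico_eq_empty (by omega)]
    simp
  | succ k ih =>
    by_cases hlN : N ≤ l
    · rw [Finset.Ico_eq_empty (by omega)]
      simp
    have hpath (j : ℕ) : ∀ l', l + 1 ≤ l' → ∀ y, ∫⁻ z in c l' ⁻¹' {c l' y},
        (if c (l' + j) z = c (l' + j) y then δ else 1) *
          ∏ i ∈ Finset.Ico l' N, holeWeight c P H (m + 1) G δ i z ∂ν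
        ≤ B j * ν (c l' ⁻¹' {c l' y}) := by
      induction j with
      | zero =>
        intro l' hl' y
        rw [hB0]
        refine le_trans ?_ (mul_le_mul_right (ih l' (by omega) y) δ)
        rw [← lintegral_const_mul' _ _ hδ']
        refine (setLIntegral_congr_fun (hc l' (measurableSet_singleton _)) fun z hz => ?_).le
        have : c l' z = c l' y := hz
        simp [this]
      | succ j ihj =>
        intro l' hl' y
        have hstep := setLIntegral_hole_step hc hr hq hp hδ (l := l') (n := l' + (j + 1))
          (b := B j) y (fun x => ih (l' + 1) (by omega) x) (by
            have := ihj (l' + 1) (by omega) y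
            rwa [show l' + 1 + j = l' + (j + 1) by ring] at this)
        rw [hB, mul_assoc]
        refine le_trans ?_ (mul_le_mul_right hstep G)
        rw [← lintegral_const_mul' _ _ hG']
        refine lintegral_mono fun z => ?_
        simp only
        rw [mul_left_comm]
        refine mul_le_mul_right ?_ _
        by_cases hN : l' < N
        · rw [Finset.prod_eq_prod_Ico_succ_bot hN]
          exact mul_le_mul_left (hwG _ _) _
        · rw [Finset.Ico_eq_empty (by omega), Finset.Ico_eq_empty (by omega)]
          simpa using hG
    by_cases hx : c l x ∈ P l
    · obtain ⟨y, hyx, hyH⟩ := hH l x hx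
      have hstep := setLIntegral_hole_step hc hr hq hp hδ (l := l) (n := l + (m + 1))
          (b := B m) y (fun x => ih (l + 1) (by omega) x) (by
            have := hpath m (l + 1) le_rfl y
            rwa [show l + 1 + m = l + (m + 1) by ring] at this)
      rw [← hyx]
      refine le_trans ?_ ((mul_le_mul_left hBm _).trans (one_mul _).le)
      rw [hB, mul_assoc]
      refine le_trans ?_ (mul_le_mul_right hstep G)
      rw [← lintegral_const_mul' _ _ hG']
      refine (setLIntegral_congr_fun (hc l (measurableSet_singleton _)) fun z hz => ?_).le
      have hz' : c l z = c l x := Eq.trans hz hyx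
      rw [Finset.prod_eq_prod_Ico_succ_bot (by omega), holeWeight, hz', if_pos hx, hyH, mul_assoc]
    · rw [cell_eq_preimage hr, ← setLIntegral_one]
      refine le_trans (le_of_eq ?_) (setLIntegral_preimage_le (ν₁ := ν) (F := fun z =>
        ∏ i ∈ Finset.Ico (l + 1) N, holeWeight c P H (m + 1) G δ i z) (hc (l + 1)) _
          fun y _ => ?_)
      · refine setLIntegral_congr_fun ?_ fun z hz => ?_
        · rw [← cell_eq_preimage hr]
          exact hc l (measurableSet_singleton _)
        · rw [← cell_eq_preimage hr] at hz
          have hz' : c l z = c l x := hz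
          rw [Finset.prod_eq_prod_Ico_succ_bot (by omega), holeWeight, hz', if_neg hx, one_mul]
      · rw [setLIntegral_one]
        exact ih (l + 1) (by omega) y

theorem ae_eventually_mul_measure_div_le {c : ℕ → X → ι} (hc : ∀ n, Measurable (c n))
    (hr : ∀ n x y, c (n + 1) x = c (n + 1) y → c n x = c n y) {ν μ : Measure X}
    (hν : ∀ x, ν (c 0 ⁻¹' {c 0 x}) ≠ ∞) {φ : ℕ → X → ℝ≥0∞} {m : ℕ}
    (hφ : ∀ N x y, c (N + m) x = c (N + m) y → φ N x = φ N y)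
    (hle : ∀ N x, ∫⁻ z in c 0 ⁻¹' {c 0 x}, φ N z ∂ν ≤ ν (c 0 ⁻¹' {c 0 x})) {ξ : ℝ} (hξ : 0 < ξ) :
    ∀ᵐ x ∂μ, ∀ᶠ N : ℕ in atTop, φ N x * (ν (c (N + m) ⁻¹' {c (N + m) x}) /
      μ (c (N + m) ⁻¹' {c (N + m) x})) ≤ ENNReal.ofReal (Real.exp (ξ * N)) := by
  refine ae_of_forall_ae_restrict_cell (c := c 0) fun x₀ => ?_
  have hconst (N : ℕ) (x y : X) (h : c (N + m) x = c (N + m) y) :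
      φ N x * (ν (c (N + m) ⁻¹' {c (N + m) x}) / μ (c (N + m) ⁻¹' {c (N + m) x})) =
      φ N y * (ν (c (N + m) ⁻¹' {c (N + m) y}) / μ (c (N + m) ⁻¹' {c (N + m) y})) := by
    rw [h, hφ N x y h]
  refine ae_eventually_le_exp (fun N => measurable_of_const_on_cells (hc (N + m)) (hconst N))
    (hν x₀) (fun N => le_trans ?_ (hle N x₀)) hξ
  have hS : c 0 ⁻¹' {c 0 x₀} = c (N + m) ⁻¹' (c (N + m) '' (c 0 ⁻¹' {c 0 x₀})) := by
    refine subset_antisymm (subset_preimage_image _ _) ?_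
    rintro z ⟨w, hw, hwz⟩
    exact (cell_eq_of_le hr (Nat.zero_le _) hwz).symm.trans hw
  rw [hS]
  refine setLIntegral_preimage_le (hc _) _ fun x _ => ?_
  have hm : MeasurableSet (c (N + m) ⁻¹' {c (N + m) x}) := hc _ (measurableSet_singleton _)
  rw [setLIntegral_congr_fun hm fun z hz => hconst N z x hz,
    setLIntegral_congr_fun hm fun z hz => hφ N z x hz, setLIntegral_const, setLIntegral_const,
    mul_assoc]
  gcongr
  rw [mul_comm]
  exact ENNReal.mul_div_le

theorem ae_eventually_sum_holeHit_arith_le {c : ℕ → X → ι} (hc : ∀ n, Measurable (c n))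
    (hr : ∀ n x y, c (n + 1) x = c (n + 1) y → c n x = c n y) {μ : Measure X} [IsFiniteMeasure μ]
    {P : ℕ → Set ι} {H : ℕ → ι → ι} {m : ℕ} {ς : ℝ} (hς : 0 < ς)
    (hε : ∀ i x, c i x ∈ P i → μ (c (i + m) ⁻¹' {H i (c i x)}) ≤
      ENNReal.ofReal (Real.exp (-(1 / ς))) * μ (c i ⁻¹' {c i x})) (a : ℕ) :
    ∀ᵐ x ∂μ, ∀ᶠ L : ℕ in atTop,
      ∑ j ∈ Finset.range L, holeHit c P H m (a + m * j) x ≤ 2 * ς * L := by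
  have hmul : ENNReal.ofReal (Real.exp (1 / ς)) * ENNReal.ofReal (Real.exp (-(1 / ς))) = 1 := by
    rw [← ENNReal.ofReal_mul (Real.exp_nonneg _), ← Real.exp_add]
    simp
  have h2 : ENNReal.ofReal (Real.exp (-1)) * 2 ≤ 1 := by
    rw [show (2 : ℝ≥0∞) = ENNReal.ofReal 2 by simp, ← ENNReal.ofReal_mul (Real.exp_nonneg _)]
    refine ENNReal.ofReal_le_one.2 ?_
    rw [Real.exp_neg, inv_mul_le_iff₀ (Real.exp_pos _)]
    linarith [Real.exp_one_gt_d9]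
  have key := ae_eventually_sum_le (c := fun j => c (a + m * j)) (ν := μ)
    (u := fun j x => 1 / ς * holeHit c P H m (a + m * j) x + -1) (fun j => hc _)
    (fun j x y h => cell_eq_of_le hr (by gcongr; omega) h) (fun x => measure_ne_top _ _)
    (fun j x y h => by
      rw [holeHit_eq_of_cell_eq hr (x := x) (y := y)]
      rwa [show a + m * j + m = a + m * (j + 1) by ring])
    (fun j x => by
      set i := a + m * j
      have hm : MeasurableSet (c i ⁻¹' {c i x}) := hc _ (measurableSet_singleton _)
      by_cases hx : c i x ∈ P i
      · have hm' : MeasurableSet (c (i + m) ⁻¹' {H i (c i x)}) := hc _ (measurableSet_singleton _)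
        calc ∫⁻ z in c i ⁻¹' {c i x},
              ENNReal.ofReal (Real.exp (1 / ς * holeHit c P H m i z + -1)) ∂μ
            ≤ ∫⁻ z in c i ⁻¹' {c i x}, ENNReal.ofReal (Real.exp (-1)) *
              (1 + (c (i + m) ⁻¹' {H i (c i x)}).indicator
                (fun _ => ENNReal.ofReal (Real.exp (1 / ς))) z) ∂μ := by
              refine setLIntegral_mono' hm fun z hz => ?_
              have hz' : c i z = c i x := hz
              rw [Real.exp_add, mul_comm, ENNReal.ofReal_mul (Real.exp_nonneg _)]
              gcongr
              rw [holeHit, hz']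
              by_cases hh : c (i + m) z = H i (c i x)
              · rw [indicator_of_mem (by exact hh)]
                simp [hx, hh]
              · simp [hh]
          _ = ENNReal.ofReal (Real.exp (-1)) * (μ (c i ⁻¹' {c i x}) +
              ENNReal.ofReal (Real.exp (1 / ς)) *
                μ (c (i + m) ⁻¹' {H i (c i x)} ∩ c i ⁻¹' {c i x})) := by
              rw [lintegral_const_mul' _ _ ENNReal.ofReal_ne_top,
                lintegral_add_left measurable_const, setLIntegral_one,
                lintegral_indicator_const hm', Measure.restrict_apply hm']
          _ ≤ ENNReal.ofReal (Real.exp (-1)) * (μ (c i ⁻¹' {c i x}) +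
              ENNReal.ofReal (Real.exp (1 / ς)) * (ENNReal.ofReal (Real.exp (-(1 / ς))) *
                μ (c i ⁻¹' {c i x}))) := by
              gcongr
              exact (measure_mono inter_subset_left).trans (hε i x hx)
          _ = (ENNReal.ofReal (Real.exp (-1)) * 2) * μ (c i ⁻¹' {c i x}) := by
              rw [← mul_assoc (ENNReal.ofReal (Real.exp (1 / ς))), hmul, one_mul, ← two_mul,
                mul_assoc]
          _ ≤ 1 * μ (c i ⁻¹' {c i x}) := by gcongr
          _ = _ := one_mul _
      · rw [← setLIntegral_one]
        refine setLIntegral_mono' hm fun z hz => ?_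
        have hz' : c i z = c i x := hz
        simp [holeHit, hz', hx])
    one_pos
  filter_upwards [key] with x hx
  filter_upwards [hx] with L hL
  rw [Finset.sum_add_distrib, ← Finset.mul_sum] at hL
  simp only [Finset.sum_const, Finset.card_range, nsmul_eq_mul] at hL
  have : 1 / ς * ∑ j ∈ Finset.range L, holeHit c P H m (a + m * j) x ≤ 2 * L := by linarith
  rw [one_div, inv_mul_le_iff₀ hς] at this
  linarith

theorem sum_range_mul_eq (f : ℕ → ℝ) (m L : ℕ) :
    ∑ i ∈ Finset.range (m * L), f i =
      ∑ a ∈ Finset.range m, ∑ j ∈ Finset.range L, f (a + m * j) := by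
  induction L with
  | zero => simp
  | succ L ih =>
    rw [mul_add_one, Finset.sum_range_add, ih, ← Finset.sum_add_distrib]
    refine Finset.sum_congr rfl fun a _ => ?_
    rw [Finset.sum_range_succ, add_comm a]

theorem ae_eventually_sum_holeHit_le {c : ℕ → X → ι} (hc : ∀ n, Measurable (c n))
    (hr : ∀ n x y, c (n + 1) x = c (n + 1) y → c n x = c n y) {μ : Measure X} [IsFiniteMeasure μ]
    {P : ℕ → Set ι} {H : ℕ → ι → ι} {m : ℕ} (hm : 0 < m) {ς : ℝ} (hς : 0 < ς)
    (hε : ∀ i x, c i x ∈ P i → μ (c (i + m) ⁻¹' {H i (c i x)}) ≤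
      ENNReal.ofReal (Real.exp (-(1 / ς))) * μ (c i ⁻¹' {c i x})) :
    ∀ᵐ x ∂μ, ∀ᶠ N : ℕ in atTop,
      ∑ i ∈ Finset.range N, holeHit c P H m i x ≤ 2 * ς * (N + m) := by
  filter_upwards [ae_all_iff.2 (ae_eventually_sum_holeHit_arith_le hc hr hς hε)] with x hx
  have hall : ∀ᶠ L : ℕ in atTop, ∀ a ∈ Finset.range m,
      ∑ j ∈ Finset.range L, holeHit c P H m (a + m * j) x ≤ 2 * ς * L :=
    (Finset.eventually_all _).2 fun a _ => hx a
  have htend : Tendsto (fun N : ℕ => N / m + 1) atTop atTop :=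
    (tendsto_add_atTop_nat 1).comp (Nat.tendsto_div_const_atTop hm.ne')
  filter_upwards [htend.eventually hall] with N hN
  have hnn (i : ℕ) : 0 ≤ holeHit c P H m i x := by
    unfold holeHit
    split_ifs <;> simp
  have hlt : N < m * (N / m + 1) := Nat.lt_mul_div_succ N hm
  calc ∑ i ∈ Finset.range N, holeHit c P H m i x
      ≤ ∑ i ∈ Finset.range (m * (N / m + 1)), holeHit c P H m i x :=
        Finset.sum_le_sum_of_subset_of_nonneg (Finset.range_mono hlt.le) fun i _ _ => hnn i
    _ ≤ ∑ a ∈ Finset.range m, 2 * ς * ((N / m + 1 : ℕ) : ℝ) := by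
        rw [sum_range_mul_eq]
        exact Finset.sum_le_sum hN
    _ = 2 * ς * ((m * (N / m) + m : ℕ) : ℝ) := by
        simp only [Finset.sum_const, Finset.card_range, nsmul_eq_mul]
        push_cast
        ring
    _ ≤ 2 * ς * (N + m) := by
        have : m * (N / m) ≤ N := Nat.mul_div_le N m
        have : ((m * (N / m) + m : ℕ) : ℝ) ≤ N + m := by exact_mod_cast Nat.add_le_add_right this m
        gcongr

theorem exists_budget {q : ℝ} (hq0 : 0 < q) (hq : q ≤ 1 / 2) {m : ℕ} (hm : q ^ m ≤ 1 / 8) :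
    ∃ B : ℕ → ℝ≥0∞, B 0 = ENNReal.ofReal (Real.exp (-3)) ∧
      (∀ k, B (k + 1) = ENNReal.ofReal (Real.exp (2 / 5 * q ^ m)) *
        (ENNReal.ofReal q * B k + ENNReal.ofReal (1 - q))) ∧ B m ≤ 1 := by
  have hqm : 0 < q ^ m := pow_pos hq0 m
  set g := 2 / 5 * q ^ m with hg
  set G := Real.exp g with hG
  have hG1 : 1 ≤ G := Real.one_le_exp (by positivity)
  have hG2 : G ≤ 1 + 21 / 50 * q ^ m := by
    have := Real.abs_exp_sub_one_sub_id_le (x := g) (by rw [abs_of_pos] <;> linarith)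
    have := (abs_le.1 this).2
    nlinarith
  have hδ : Real.exp (-3) ≤ 6 / 100 := by
    rw [Real.exp_neg, inv_le_comm₀ (Real.exp_pos _) (by norm_num),
      show (3 : ℝ) = 1 + 1 + 1 by norm_num, Real.exp_add, Real.exp_add]
    have := Real.exp_one_gt_d9
    have h1 : (2.7 : ℝ) ≤ Real.exp 1 := by linarith
    nlinarith [mul_le_mul h1 h1 (by norm_num) (by positivity)]
  let r : ℕ → ℝ := fun n => Nat.rec (Real.exp (-3)) (fun _ b => G * (q * b + (1 - q))) n
  have hr0 : r 0 = Real.exp (-3) := rfl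
  have hrs (k : ℕ) : r (k + 1) = G * (q * r k + (1 - q)) := rfl
  have hrnn (k : ℕ) : 0 ≤ r k := by
    induction k with
    | zero => exact Real.exp_nonneg _
    | succ k ih => rw [hrs]; have : 0 ≤ 1 - q := by linarith
                   positivity
  have hGq : G * q ≤ 53 / 100 := by nlinarith
  set s := (G - 1) / (1 - G * q) with hs
  have hs1 : s * (1 - G * q) = G - 1 := div_mul_cancel₀ _ (by linarith)
  have hs0 : 0 ≤ s := div_nonneg (by linarith) (by linarith)
  have hs2 : s ≤ 94 / 100 * q ^ m := by
    rw [hs, div_le_iff₀ (by linarith)]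
    nlinarith
  have hinv (k : ℕ) : q ^ k * (94 / 100) ≤ 1 - r k + s := by
    induction k with
    | zero => rw [hr0]; simp; linarith
    | succ k ih =>
      have e : 1 - r (k + 1) + s = G * q * (1 - r k + s) := by
        rw [hrs]; linear_combination hs1
      rw [e, pow_succ]
      have h0 : 0 ≤ q ^ k * (94 / 100) := by positivity
      calc q ^ k * q * (94 / 100) = 1 * q * (q ^ k * (94 / 100)) := by ring
        _ ≤ G * q * (1 - r k + s) := by gcongr
  refine ⟨fun k => ENNReal.ofReal (r k), rfl, fun k => ?_, ?_⟩
  · simp only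
    rw [hrs, ENNReal.ofReal_mul (by positivity),
      ENNReal.ofReal_add (mul_nonneg hq0.le (hrnn k)) (by linarith), ENNReal.ofReal_mul hq0.le]
  · refine ENNReal.ofReal_le_one.2 ?_
    have := hinv m
    linarith

open Classical in
/-- Lower bound for the mass of cells, when many cells along the way have holes. -/
theorem ae_eventually_exp_mul_measure_le {c : ℕ → X → ι} (hc : ∀ n, Measurable (c n))
    (hr : ∀ n x y, c (n + 1) x = c (n + 1) y → c n x = c n y) {μ ν : Measure X}
    [IsFiniteMeasure μ] (hν : ∀ x, ν (c 0 ⁻¹' {c 0 x}) ≠ ∞)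
    {q : ℝ} (hq0 : 0 < q) (hq : q ≤ 1 / 2)
    (hνq : ∀ n x, ν (c (n + 1) ⁻¹' {c (n + 1) x}) = ENNReal.ofReal q * ν (c n ⁻¹' {c n x}))
    {m : ℕ} (hm : q ^ m ≤ 1 / 8) {P : ℕ → Set ι} {H : ℕ → ι → ι} {ς : ℝ} (hς : 0 < ς)
    (hH : ∀ i x, c i x ∈ P i → ∃ y, c i y = c i x ∧ c (i + m) y = H i (c i x))
    (hε : ∀ i x, c i x ∈ P i → μ (c (i + m) ⁻¹' {H i (c i x)}) ≤
      ENNReal.ofReal (Real.exp (-(1 / ς))) * μ (c i ⁻¹' {c i x})) :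
    ∀ᵐ x ∂μ, ∀ᶠ N : ℕ in atTop,
      ENNReal.ofReal (Real.exp (2 / 5 * q ^ m * (∑ i ∈ Finset.range N,
          if c i x ∈ P i then (1 : ℝ) else 0) - 7 * ς * (N + m))) *
        ν (c (N + m) ⁻¹' {c (N + m) x}) ≤ μ (c (N + m) ⁻¹' {c (N + m) x}) := by
  obtain ⟨B, hB0, hB, hBm⟩ := exists_budget hq0 hq hm
  have hm0 : m ≠ 0 := by
    rintro rfl
    norm_num at hm
  obtain ⟨k, rfl⟩ := Nat.exists_eq_succ_of_ne_zero hm0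
  set g := 2 / 5 * q ^ k.succ with hg
  have hg0 : 0 ≤ g := by positivity
  have hfin (n : ℕ) (x : X) : ν (c n ⁻¹' {c n x}) ≠ ∞ :=
    ne_top_of_le_ne_top (hν x) (measure_mono fun z hz => cell_eq_of_le hr (Nat.zero_le n) hz)
  have hνp (n : ℕ) (x : X) : ν (c n ⁻¹' {c n x} \ c (n + 1) ⁻¹' {c (n + 1) x}) =
      ENNReal.ofReal (1 - q) * ν (c n ⁻¹' {c n x}) := by
    have hsub : c (n + 1) ⁻¹' {c (n + 1) x} ⊆ c n ⁻¹' {c n x} := fun z hz => hr n z x hz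
    rw [measure_sdiff hsub (hc _ (measurableSet_singleton _)).nullMeasurableSet (hfin _ _), hνq,
      ENNReal.ofReal_sub _ hq0.le, ENNReal.ofReal_one,
      ENNReal.sub_mul fun _ _ => hfin _ _, one_mul]
  have hw (i : ℕ) (x : X) : holeWeight c P H (k + 1) (ENNReal.ofReal (Real.exp g))
      (ENNReal.ofReal (Real.exp (-3))) i x = ENNReal.ofReal (Real.exp
        (g * (if c i x ∈ P i then (1 : ℝ) else 0) - 3 * holeHit c P H (k + 1) i x)) := by
    unfold holeWeight holeHit
    by_cases h1 : c i x ∈ P i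
    · by_cases h2 : c (i + (k + 1)) x = H i (c i x)
      · simp only [h1, h2, and_self, if_true, mul_one]
        rw [← ENNReal.ofReal_mul (Real.exp_nonneg _), ← Real.exp_add, sub_eq_add_neg]
      · simp [h1, h2]
    · simp [h1]
  have hA := ae_eventually_mul_measure_div_le (μ := μ) hc hr hν (m := k + 1)
    (φ := fun N x => ∏ i ∈ Finset.range N, holeWeight c P H (k + 1) (ENNReal.ofReal (Real.exp g))
      (ENNReal.ofReal (Real.exp (-3))) i x)
    (fun N x y h => Finset.prod_congr rfl fun i hi => by
      have hi := Finset.mem_range.1 hi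
      rw [holeWeight, holeWeight, cell_eq_of_le hr (by omega : i ≤ N + (k + 1)) h,
        cell_eq_of_le hr (by omega : i + (k + 1) ≤ N + (k + 1)) h])
    (fun N x => by
      simp only [Finset.range_eq_Ico]
      exact setLIntegral_prod_holeWeight_le hc hr hνq hνp
        (ENNReal.ofReal_le_one.2 (by simp)) ENNReal.ofReal_ne_top
        (ENNReal.one_le_ofReal.2 (Real.one_le_exp hg0)) ENNReal.ofReal_ne_top hB0 hB hBm hH N N 0
        (by omega) x) hς
  filter_upwards [hA, ae_eventually_sum_holeHit_le hc hr k.succ_pos hς hε] with x hx hx'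
  filter_upwards [hx, hx'] with N hN hN'
  simp only [hw] at hN
  rw [← ofReal_exp_sum, Finset.sum_sub_distrib, ← Finset.mul_sum, ← Finset.mul_sum,
    ← mul_div_assoc, ENNReal.div_le_iff_le_mul (Or.inr ENNReal.ofReal_ne_top)
    (Or.inl (measure_ne_top _ _))] at hN
  set S := ∑ i ∈ Finset.range N, if c i x ∈ P i then (1 : ℝ) else 0
  set E := ∑ i ∈ Finset.range N, holeHit c P H (k + 1) i x
  have h1 : Real.exp (g * S - 7 * ς * (N + (k.succ : ℕ))) ≤
      Real.exp (-(ς * N)) * Real.exp (g * S - 3 * E) := by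
    rw [← Real.exp_add]
    refine Real.exp_le_exp.2 ?_
    have : 0 ≤ ς * (k.succ : ℕ) := by positivity
    linarith
  have h2 : ENNReal.ofReal (Real.exp (-(ς * N))) * ENNReal.ofReal (Real.exp (ς * N)) = 1 := by
    rw [← ENNReal.ofReal_mul (Real.exp_nonneg _), ← Real.exp_add]
    simp
  calc _ ≤ ENNReal.ofReal (Real.exp (-(ς * N)) * Real.exp (g * S - 3 * E)) *
        ν (c (N + k.succ) ⁻¹' {c (N + k.succ) x}) := by gcongr
    _ = ENNReal.ofReal (Real.exp (-(ς * N))) * (ENNReal.ofReal (Real.exp (g * S - 3 * E)) *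
        ν (c (N + k.succ) ⁻¹' {c (N + k.succ) x})) := by
        rw [ENNReal.ofReal_mul (Real.exp_nonneg _), mul_assoc]
    _ ≤ ENNReal.ofReal (Real.exp (-(ς * N))) * (ENNReal.ofReal (Real.exp (ς * N)) *
        μ (c (N + k.succ) ⁻¹' {c (N + k.succ) x})) := by
        gcongr
    _ = _ := by rw [← mul_assoc, h2, one_mul]

end Cells

section Grid

variable {d : ℕ}

/-- Index of the dyadic cube of side `2⁻ⁿ` containing `x`. -/
noncomputable def cellIdx (n : ℕ) (x : EuclideanSpace ℝ (Fin d)) : Fin d → ℤ :=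
  fun k => ⌊(2 : ℝ) ^ n * x k⌋

theorem measurable_cellIdx (n : ℕ) : Measurable (cellIdx (d := d) n) :=
  measurable_pi_iff.2 fun k => Int.measurable_floor.comp
    ((EuclideanSpace.proj k : EuclideanSpace ℝ (Fin d) →L[ℝ] ℝ).measurable.const_mul _)

theorem cellIdx_eq_iff {n : ℕ} {x : EuclideanSpace ℝ (Fin d)} {i : Fin d → ℤ} :
    cellIdx n x = i ↔ ∀ k, (i k : ℝ) ≤ 2 ^ n * x k ∧ (2 : ℝ) ^ n * x k < i k + 1 := by
  rw [funext_iff]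
  exact forall_congr' fun k => Int.floor_eq_iff

theorem cellIdx_eq_div (n : ℕ) (x : EuclideanSpace ℝ (Fin d)) (k : Fin d) :
    cellIdx n x k = cellIdx (n + 1) x k / 2 := by
  rw [cellIdx, cellIdx, ← Nat.cast_ofNat (R := ℤ), ← Int.floor_div_natCast]
  congr 1
  push_cast
  ring

theorem cellIdx_eq_of_succ (n : ℕ) (x y : EuclideanSpace ℝ (Fin d))
    (h : cellIdx (n + 1) x = cellIdx (n + 1) y) : cellIdx n x = cellIdx n y := by
  funext k
  rw [cellIdx_eq_div n x, cellIdx_eq_div n y, h]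

theorem volume_preimage_cellIdx (n : ℕ) (i : Fin d → ℤ) :
    volume (cellIdx n ⁻¹' {i}) = ENNReal.ofReal (((1 / 2) ^ d) ^ n) := by
  have h2 : (0 : ℝ) < 2 ^ n := by positivity
  have : cellIdx n ⁻¹' {i} = WithLp.ofLp ⁻¹' (Set.pi univ fun k : Fin d =>
      Ico ((i k : ℝ) / 2 ^ n) (((i k : ℝ) + 1) / 2 ^ n)) := by
    ext x
    simp only [mem_preimage, mem_singleton_iff, cellIdx_eq_iff, Set.mem_pi, mem_univ, true_imp_iff,
      mem_Ico, div_le_iff₀' h2, lt_div_iff₀' h2]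
  rw [this, (PiLp.volume_preserving_ofLp (Fin d)).measure_preimage
    (MeasurableSet.univ_pi fun _ => measurableSet_Ico).nullMeasurableSet, Real.volume_pi_Ico]
  simp only [← sub_div, add_sub_cancel_left, Finset.prod_const, Finset.card_univ,
    Fintype.card_fin]
  rw [← ENNReal.ofReal_pow (by positivity), one_div, one_div, ← inv_pow, ← pow_mul, ← pow_mul,
    mul_comm]

theorem dist_le_of_cellIdx_eq {n : ℕ} {x y : EuclideanSpace ℝ (Fin d)}
    (h : cellIdx n x = cellIdx n y) : dist x y ≤ √d * (1 / 2) ^ n := by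
  have hk (k : Fin d) : (dist (x k) (y k)) ^ 2 ≤ ((1 / 2) ^ n) ^ 2 := by
    have := Int.abs_sub_lt_one_of_floor_eq_floor (congrFun h k)
    rw [← mul_sub, abs_mul, abs_of_pos (by positivity : (0 : ℝ) < 2 ^ n)] at this
    gcongr
    rw [Real.dist_eq, one_div, inv_pow, ← one_div, le_div_iff₀' (by positivity)]
    exact this.le
  rw [EuclideanSpace.dist_eq, ← Real.sqrt_sq (by positivity : (0 : ℝ) ≤ (1 / 2) ^ n),
    ← Real.sqrt_mul (Nat.cast_nonneg d)]
  refine Real.sqrt_le_sqrt ((Finset.sum_le_sum fun k _ => hk k).trans ?_)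
  simp

/-- `u` lies in that subcube of its level `j + 1` dyadic cube which touches the centre of the
level `j` cube of `u`. -/
def IsDeep (j : ℕ) (u : EuclideanSpace ℝ (Fin d)) : Prop :=
  ∀ k, cellIdx (j + 2) u k =
    2 * cellIdx (j + 1) u k + if Even (cellIdx (j + 1) u k) then 1 else 0

theorem isDeep_iff_of_cellIdx_eq {j : ℕ} {x y : EuclideanSpace ℝ (Fin d)}
    (h : cellIdx (j + 2) x = cellIdx (j + 2) y) : IsDeep j x ↔ IsDeep j y := by
  rw [IsDeep, IsDeep, h, cellIdx_eq_of_succ _ _ _ h]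

theorem isDeep_iff_cellIdx_eq {j : ℕ} {b : Fin d → ℤ} {x : EuclideanSpace ℝ (Fin d)}
    (h : cellIdx (j + 1) x = b) :
    IsDeep j x ↔ cellIdx (j + 2) x = fun k => 2 * b k + if Even (b k) then 1 else 0 := by
  rw [IsDeep, h, funext_iff]

theorem measurableSet_isDeep (j : ℕ) :
    MeasurableSet {x : EuclideanSpace ℝ (Fin d) | IsDeep j x} := by
  have : {x : EuclideanSpace ℝ (Fin d) | IsDeep j x} =
      cellIdx (j + 2) ⁻¹' (cellIdx (j + 2) '' {x | IsDeep j x}) := by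
    refine subset_antisymm (subset_preimage_image _ _) ?_
    rintro x ⟨y, hy, hyx⟩
    exact (isDeep_iff_of_cellIdx_eq hyx).1 hy
  rw [this]
  exact measurable_cellIdx _ (Set.to_countable _).measurableSet

theorem volume_isDeep_inter (j : ℕ) (x : EuclideanSpace ℝ (Fin d)) :
    volume ({z | IsDeep j z} ∩ cellIdx (j + 1) ⁻¹' {cellIdx (j + 1) x}) =
      ENNReal.ofReal ((1 / 2) ^ d) * volume (cellIdx (j + 1) ⁻¹' {cellIdx (j + 1) x}) := by
  set b := cellIdx (j + 1) x
  have : {z | IsDeep j z} ∩ cellIdx (j + 1) ⁻¹' {b} =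
      cellIdx (j + 2) ⁻¹' {fun k => 2 * b k + if Even (b k) then 1 else 0} := by
    ext z
    constructor
    · rintro ⟨h1, h2⟩
      exact (isDeep_iff_cellIdx_eq h2).1 h1
    · intro h
      have hz : cellIdx (j + 1) z = b := by
        funext k
        have hk : cellIdx (j + 2) z k = _ := congrFun h k
        rw [cellIdx_eq_div, hk]
        split_ifs <;> omega
      exact ⟨(isDeep_iff_cellIdx_eq hz).2 h, hz⟩
  rw [this, volume_preimage_cellIdx, volume_preimage_cellIdx, ← ENNReal.ofReal_mul (by positivity),
    ← pow_succ']

theorem cellIdx_eq_of_isDeep {j : ℕ} {u z : EuclideanSpace ℝ (Fin d)} (hu : IsDeep j u)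
    (hz : dist z u ≤ (1 / 2) ^ (j + 2)) : cellIdx j z = cellIdx j u := by
  funext k
  have h1 : |z k - u k| ≤ (1 / 2) ^ (j + 2) := by
    refine le_trans ?_ hz
    rw [dist_eq_norm]
    exact PiLp.norm_apply_le (z - u) k
  have h2 : |(2 : ℝ) ^ j * z k - 2 ^ j * u k| ≤ 1 / 4 := by
    rw [← mul_sub, abs_mul, abs_of_pos (by positivity : (0 : ℝ) < 2 ^ j)]
    calc (2 : ℝ) ^ j * |z k - u k| ≤ 2 ^ j * (1 / 2) ^ (j + 2) := by gcongr
      _ = 1 / 4 := by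
        rw [pow_add, ← mul_assoc, ← mul_pow]
        norm_num
  have h3 := hu k
  have e1 : cellIdx (j + 2) u k = ⌊4 * ((2 : ℝ) ^ j * u k)⌋ := by
    rw [cellIdx]; congr 1; ring
  rw [e1, Int.floor_eq_iff] at h3
  have h4 := cellIdx_eq_div j u k
  obtain ⟨e, he⟩ : ∃ e, cellIdx j u k = e := ⟨_, rfl⟩
  rw [he] at h4 ⊢
  rw [abs_le] at h2
  refine Int.floor_eq_iff.2 ?_
  rcases Int.even_or_odd' (cellIdx (j + 1) u k) with ⟨e', h5 | h5⟩
  · have : e' = e := by omega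
    subst this
    rw [h5, if_pos (by simp)] at h3
    push_cast at h3
    constructor <;> linarith
  · have : e' = e := by omega
    subst this
    rw [h5, if_neg (by simp)] at h3
    push_cast at h3
    constructor <;> linarith

end Grid

section Deepness

variable {d : ℕ}

theorem exp_mul_one_sub_add_mul_exp_neg_le_one {q s : ℝ} (hq : 0 ≤ q) (hs : 0 ≤ s) :
    Real.exp (q * s * (1 - s)) * (q * Real.exp (-s) + (1 - q)) ≤ 1 := by
  have h1 : Real.exp (-s) ≤ 1 - s + s ^ 2 := by
    rw [Real.exp_neg, inv_le_iff_one_le_mul₀ (Real.exp_pos _)]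
    nlinarith [Real.add_one_le_exp s, mul_nonneg hs (sq_nonneg s),
      mul_nonneg (by nlinarith : 0 ≤ 1 - s + s ^ 2) (sub_nonneg.2 (Real.add_one_le_exp s))]
  have h2 : q * Real.exp (-s) + (1 - q) ≤ Real.exp (-(q * s * (1 - s))) := by
    refine le_trans ?_ (Real.add_one_le_exp _)
    nlinarith
  calc _ ≤ Real.exp (q * s * (1 - s)) * Real.exp (-(q * s * (1 - s))) := by gcongr
    _ = 1 := by rw [← Real.exp_add]; simp

open Classical in
theorem setLIntegral_exp_isDeep_le (j : ℕ) (x : EuclideanSpace ℝ (Fin d)) {s : ℝ} (hs : 0 ≤ s) :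
    ∫⁻ z in cellIdx (j + 1) ⁻¹' {cellIdx (j + 1) x}, ENNReal.ofReal (Real.exp
      ((1 / 2) ^ d * s * (1 - s) - s * if IsDeep j z then 1 else 0)) ≤
    volume (cellIdx (j + 1) ⁻¹' {cellIdx (j + 1) x}) := by
  set q : ℝ := (1 / 2) ^ d with hq
  have hq0 : 0 ≤ q := by positivity
  have hq1 : q ≤ 1 := pow_le_one₀ (by norm_num) (by norm_num)
  set A := cellIdx (j + 1) ⁻¹' {cellIdx (j + 1) x}
  have hA : MeasurableSet A := measurable_cellIdx _ (measurableSet_singleton _)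
  set D := {z : EuclideanSpace ℝ (Fin d) | IsDeep j z}
  have hD : MeasurableSet D := measurableSet_isDeep j
  have hAtop : volume A ≠ ∞ := by
    rw [volume_preimage_cellIdx]
    exact ENNReal.ofReal_ne_top
  have hAD : volume (A ∩ D) = ENNReal.ofReal q * volume A := by
    rw [inter_comm]
    exact volume_isDeep_inter j x
  have hAD' : volume (A \ D) = ENNReal.ofReal (1 - q) * volume A := by
    rw [← sdiff_self_inter, measure_sdiff inter_subset_left (hA.inter hD).nullMeasurableSet
      (ne_top_of_le_ne_top hAtop (measure_mono inter_subset_left)), hAD,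
      ENNReal.ofReal_sub _ hq0, ENNReal.ofReal_one, ENNReal.sub_mul fun _ _ => hAtop, one_mul]
  rw [← lintegral_inter_add_sdiff _ A hD,
    setLIntegral_congr_fun (g := fun _ => ENNReal.ofReal (Real.exp (q * s * (1 - s) - s)))
      (hA.inter hD) fun z hz => by simp [show IsDeep j z from hz.2],
    setLIntegral_congr_fun (g := fun _ => ENNReal.ofReal (Real.exp (q * s * (1 - s))))
      (hA.diff hD) fun z hz => by simp [show ¬ IsDeep j z from hz.2],
    setLIntegral_const, setLIntegral_const, hAD, hAD', ← mul_assoc, ← mul_assoc, ← add_mul,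
    ← ENNReal.ofReal_mul (Real.exp_nonneg _), ← ENNReal.ofReal_mul (Real.exp_nonneg _),
    ← ENNReal.ofReal_add (by positivity) (mul_nonneg (Real.exp_nonneg _) (sub_nonneg.2 hq1))]
  refine mul_le_of_le_one_left' (ENNReal.ofReal_le_one.2 ?_)
  refine le_trans (le_of_eq ?_) (exp_mul_one_sub_add_mul_exp_neg_le_one hq0 hs)
  rw [sub_eq_add_neg, Real.exp_add]
  ring

open Classical in
theorem ae_eventually_sum_isDeep_ge (S : Set ℕ) {s : ℝ} (hs : 0 < s) :
    ∀ᵐ u : EuclideanSpace ℝ (Fin d), ∀ᶠ L : ℕ in atTop,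
      (1 / 2) ^ d * (∑ j ∈ Finset.range L, if j ∈ S then (1 : ℝ) else 0) - 2 * s * L ≤
        ∑ j ∈ Finset.range L, if j ∈ S ∧ IsDeep j u then (1 : ℝ) else 0 := by
  set q : ℝ := (1 / 2) ^ d with hq
  have hq0 : 0 ≤ q := by positivity
  have hq1 : q ≤ 1 := pow_le_one₀ (by norm_num) (by norm_num)
  have key := ae_eventually_sum_le (c := fun j => cellIdx (d := d) (j + 1)) (ν := volume)
    (u := fun j x => if j ∈ S then q * s * (1 - s) - s * (if IsDeep j x then 1 else 0) else 0)
    (fun j => measurable_cellIdx _) (fun j => cellIdx_eq_of_succ _)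
    (fun x => by rw [volume_preimage_cellIdx]; exact ENNReal.ofReal_ne_top)
    (fun j x y h => by simp only [isDeep_iff_of_cellIdx_eq h])
    (fun j x => by
      by_cases hj : j ∈ S
      · simpa only [hj, if_true] using setLIntegral_exp_isDeep_le j x hs.le
      · simp [hj])
    (sq_pos_of_pos hs)
  filter_upwards [key] with u hu
  filter_upwards [hu] with L hL
  set n := ∑ j ∈ Finset.range L, if j ∈ S then (1 : ℝ) else 0 with hn
  set D := ∑ j ∈ Finset.range L, if j ∈ S ∧ IsDeep j u then (1 : ℝ) else 0 with hD
  have hnL : n ≤ L := by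
    calc n ≤ ∑ j ∈ Finset.range L, (1 : ℝ) :=
          Finset.sum_le_sum fun j _ => by split_ifs <;> norm_num
      _ = L := by simp
  have hn0 : 0 ≤ n := Finset.sum_nonneg fun j _ => by split_ifs <;> norm_num
  have e : (∑ j ∈ Finset.range L, if j ∈ S then
      q * s * (1 - s) - s * (if IsDeep j u then 1 else 0) else 0) =
      q * s * (1 - s) * n - s * D := by
    rw [hn, hD, Finset.mul_sum, Finset.mul_sum, ← Finset.sum_sub_distrib]
    refine Finset.sum_congr rfl fun j _ => ?_
    by_cases hj : j ∈ S <;> simp [hj]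
  rw [e] at hL
  have h2 : s * (q * (1 - s) * n - D) ≤ s * (s * L) := by linarith
  have h3 := le_of_mul_le_mul_left h2 hs
  nlinarith [mul_nonneg hs.le (sub_nonneg.2 hnL),
    mul_nonneg hs.le (mul_nonneg hn0 (sub_nonneg.2 hq1))]

open Classical in
/-- Some translate of the dyadic grid sees almost all points deeply inside cubes with the
expected frequency, along prescribed sets of scales. -/
theorem exists_ae_eventually_sum_isDeep_ge (μ : Measure (EuclideanSpace ℝ (Fin d))) [SFinite μ]
    {S : ℕ → Set (EuclideanSpace ℝ (Fin d))} (hS : ∀ j, MeasurableSet (S j)) {s : ℝ}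
    (hs : 0 < s) :
    ∃ t, ∀ᵐ x ∂μ, ∀ᶠ L : ℕ in atTop,
      (1 / 2) ^ d * (∑ j ∈ Finset.range L, if x ∈ S j then (1 : ℝ) else 0) - 2 * s * L ≤
        ∑ j ∈ Finset.range L, if x ∈ S j ∧ IsDeep j (x + t) then (1 : ℝ) else 0 := by
  have hx (x : EuclideanSpace ℝ (Fin d)) : ∀ᵐ t, ∀ᶠ L : ℕ in atTop,
      (1 / 2) ^ d * (∑ j ∈ Finset.range L, if x ∈ S j then (1 : ℝ) else 0) - 2 * s * L ≤
        ∑ j ∈ Finset.range L, if x ∈ S j ∧ IsDeep j (x + t) then (1 : ℝ) else 0 :=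
    (measurePreserving_add_left volume x).quasiMeasurePreserving.ae
      (ae_eventually_sum_isDeep_ge {j | x ∈ S j} hs)
  have hmeas : MeasurableSet {p : EuclideanSpace ℝ (Fin d) × EuclideanSpace ℝ (Fin d) |
      ∀ᶠ L : ℕ in atTop,
      (1 / 2) ^ d * (∑ j ∈ Finset.range L, if p.1 ∈ S j then (1 : ℝ) else 0) - 2 * s * L ≤
        ∑ j ∈ Finset.range L, if p.1 ∈ S j ∧ IsDeep j (p.1 + p.2) then (1 : ℝ) else 0} := by
    simp only [eventually_atTop, ofPred_exists, ofPred_forall]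
    refine .iUnion fun a => .iInter fun L => .iInter fun _ => measurableSet_le ?_ ?_
    · refine Measurable.sub_const (Measurable.const_mul
        (Finset.measurable_fun_sum _ fun j _ => ?_) _) _
      exact Measurable.ite (measurable_fst (hS j)) measurable_const measurable_const
    · refine Finset.measurable_fun_sum _ fun j _ => ?_
      exact Measurable.ite ((measurable_fst (hS j)).inter
        ((measurable_fst.add measurable_snd) (measurableSet_isDeep j)))
        measurable_const measurable_const
  exact ((Measure.ae_ae_comm hmeas).1 (ae_of_all _ hx)).exists

end Deepness

section Porosity

variable {d : ℕ}

/-- Points `x` such that some ball of radius `ρ`, centred within `r` of `x` at a point of a fixed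
countable dense set, has small measure compared to `B(x, r)`. -/
def holeSet (μ : Measure (EuclideanSpace ℝ (Fin d))) (ε ρ r : ℝ) :
    Set (EuclideanSpace ℝ (Fin d)) :=
  {x | ∃ k : ℕ, dist (TopologicalSpace.denseSeq (EuclideanSpace ℝ (Fin d)) k) x ≤ r ∧
    μ (closedBall (TopologicalSpace.denseSeq (EuclideanSpace ℝ (Fin d)) k) ρ) ≤
      ENNReal.ofReal ε * μ (closedBall x r)}

theorem measurable_measure_closedBall (μ : Measure (EuclideanSpace ℝ (Fin d))) [SFinite μ] (r : ℝ) :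
    Measurable fun x => μ (closedBall x r) := by
  have : MeasurableSet {p : EuclideanSpace ℝ (Fin d) × EuclideanSpace ℝ (Fin d) |
      dist p.2 p.1 ≤ r} := measurableSet_le (by fun_prop) measurable_const
  exact measurable_measure_prodMk_left this

theorem measurableSet_holeSet (μ : Measure (EuclideanSpace ℝ (Fin d))) [SFinite μ] (ε ρ r : ℝ) :
    MeasurableSet (holeSet μ ε ρ r) := by
  simp only [holeSet, ofPred_exists]
  refine .iUnion fun k => .inter ?_ ?_
  · exact measurableSet_le (measurable_const.dist measurable_id) measurable_const
  · exact measurableSet_le measurable_const ((measurable_measure_closedBall μ r).const_mul _)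

theorem mem_holeSet_of_le_por {μ : Measure (EuclideanSpace ℝ (Fin d))}
    {x : EuclideanSpace ℝ (Fin d)} {r ε ρ α : ℝ} (hr : 0 < r) (hρ : 0 ≤ ρ) (hρα : ρ < α * r)
    (h : α ≤ por μ x r ε) : x ∈ holeSet μ ε ρ r := by
  have h1 : ρ / r < por μ x r ε := lt_of_lt_of_le ((div_lt_iff₀ hr).2 hρα) h
  rw [por] at h1
  obtain ⟨a, ⟨-, y, hy1, hy2⟩, ha⟩ := exists_lt_of_lt_csSup (nonempty_iff_ne_empty.2 fun he => by
    rw [he, Real.sSup_empty] at h1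
    exact absurd h1 (not_lt.2 (by positivity))) h1
  rw [div_lt_iff₀ hr] at ha
  obtain ⟨k, hk⟩ := (TopologicalSpace.denseRange_denseSeq
    (EuclideanSpace ℝ (Fin d))).exists_dist_lt y (sub_pos.2 ha)
  rw [dist_comm] at hk
  refine ⟨k, hy1 (mem_closedBall.2 (by linarith)), le_trans (measure_mono ?_) hy2⟩
  exact closedBall_subset_closedBall' (by linarith)

open Classical in
theorem eventually_sum_ge_of_le_liminf {p T : ℕ → Prop} {η b : ℝ}
    (h : η ≤ liminf (fun n : ℕ => (Set.ncard {i : ℕ | i < n ∧ p i} : ℝ) / n) atTop)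
    (hb0 : 0 ≤ b) (hb : b < η) (k : ℕ) (hT : ∀ i, p (i + k) → T i) :
    ∀ᶠ n : ℕ in atTop, b * n - k ≤ ∑ i ∈ Finset.range n, if T i then (1 : ℝ) else 0 := by
  have h1 := eventually_lt_of_lt_liminf (hb.trans_le h)
    (isBoundedUnder_of ⟨0, fun n => by positivity⟩)
  filter_upwards [(tendsto_add_atTop_nat k).eventually h1, eventually_gt_atTop 0] with n hn hn0
  rw [lt_div_iff₀ (by positivity)] at hn
  have h2 : Set.ncard {i : ℕ | i < n + k ∧ p i} ≤
      k + ((Finset.range n).filter T).card := by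
    have hsub : {i : ℕ | i < n + k ∧ p i} ⊆
        ((Finset.range k ∪ ((Finset.range n).filter T).image (· + k) : Finset ℕ) : Set ℕ) := by
      rintro i ⟨hi, hpi⟩
      simp only [Finset.coe_union, Finset.coe_range, Finset.coe_image, Finset.coe_filter,
        Finset.mem_range, mem_union, mem_Iio, mem_image]
      by_cases hik : i < k
      · exact Or.inl hik
      · obtain ⟨j, rfl⟩ := Nat.exists_eq_add_of_le' (not_lt.1 hik)
        exact Or.inr ⟨j, ⟨by omega, hT j hpi⟩, rfl⟩
    refine (Set.ncard_le_ncard hsub (Finset.finite_toSet _)).trans ?_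
    rw [Set.ncard_coe_finset]
    refine (Finset.card_union_le _ _).trans ?_
    rw [Finset.card_range]
    exact Nat.add_le_add_left Finset.card_image_le _
  have h3 : (Set.ncard {i : ℕ | i < n + k ∧ p i} : ℝ) ≤ k + ((Finset.range n).filter T).card := by
    exact_mod_cast h2
  rw [Finset.sum_boole]
  push_cast at hn
  have : 0 ≤ b * k := by positivity
  linarith

end Porosity

section Dimension

variable {d : ℕ}

theorem upperLocalDim_le_of_eventually {μ : Measure (EuclideanSpace ℝ (Fin d))} [IsFiniteMeasure μ]
    {x : EuclideanSpace ℝ (Fin d)} {A K : ℝ} (hA : 0 ≤ A) (hK : 0 < K)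
    (h : ∀ᶠ n : ℕ in atTop, Real.exp (-(A * n)) ≤ (μ (closedBall x (K * (1 / 2) ^ n))).toReal) :
    upperLocalDim μ x ≤ ((A / Real.log 2 : ℝ) : EReal) := by
  have hl2 : 0 < Real.log 2 := Real.log_pos one_lt_two
  have hlog : Tendsto Real.log (nhdsWithin 0 (Ioi 0)) atBot := Real.tendsto_log_nhdsGT_zero
  have hlim : Tendsto (fun r : ℝ => A / Real.log 2 +
      A * (Real.log K / Real.log 2 + 1) * (-(Real.log r))⁻¹) (nhdsWithin 0 (Ioi 0))
      (nhds (A / Real.log 2)) := by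
    have h1 : Tendsto (fun r : ℝ => (-(Real.log r))⁻¹) (nhdsWithin 0 (Ioi 0)) (nhds 0) :=
      tendsto_inv_atTop_zero.comp (tendsto_neg_atBot_atTop.comp hlog)
    simpa using (h1.const_mul (A * (Real.log K / Real.log 2 + 1))).const_add (A / Real.log 2)
  have hn : Tendsto (fun r : ℝ => ⌈(Real.log K - Real.log r) / Real.log 2⌉₊)
      (nhdsWithin 0 (Ioi 0)) atTop := by
    refine tendsto_nat_ceil_atTop.comp (Tendsto.atTop_div_const hl2 ?_)
    simp only [sub_eq_add_neg]
    exact tendsto_atTop_add_const_left _ _ (tendsto_neg_atBot_atTop.comp hlog)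
  rw [← ((continuous_coe_real_ereal.tendsto _).comp hlim).limsup_eq, upperLocalDim]
  refine limsup_le_limsup ?_
  filter_upwards [hn.eventually h, self_mem_nhdsWithin, hlog.eventually (eventually_lt_atBot 0),
    hlog.eventually (eventually_le_atBot (Real.log K))] with r hr hr0 hr1 hrK
  have hr0 : 0 < r := hr0
  set n := ⌈(Real.log K - Real.log r) / Real.log 2⌉₊ with hnr
  have hn1 : (Real.log K - Real.log r) / Real.log 2 ≤ n := Nat.le_ceil _
  have hn2 : (n : ℝ) < (Real.log K - Real.log r) / Real.log 2 + 1 :=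
    Nat.ceil_lt_add_one (div_nonneg (by linarith) hl2.le)
  have hle : K * (1 / 2) ^ n ≤ r := by
    rw [← Real.log_le_log_iff (by positivity) hr0, Real.log_mul hK.ne' (by positivity),
      Real.log_pow, one_div, Real.log_inv]
    rw [div_le_iff₀ hl2] at hn1
    linarith
  have hm : Real.exp (-(A * n)) ≤ (μ (closedBall x r)).toReal :=
    hr.trans (ENNReal.toReal_mono (measure_ne_top _ _)
      (measure_mono (closedBall_subset_closedBall hle)))
  have hlm : -(A * n) ≤ Real.log ((μ (closedBall x r)).toReal) := by
    rw [← Real.log_exp (-(A * n))]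
    exact Real.log_le_log (Real.exp_pos _) hm
  refine EReal.coe_le_coe_iff.2 ?_
  have hpos : 0 < -Real.log r := by linarith
  have e : Real.log ((μ (closedBall x r)).toReal) / Real.log r =
      -Real.log ((μ (closedBall x r)).toReal) / (-Real.log r) := by rw [neg_div_neg_eq]
  rw [e, div_le_iff₀ hpos, add_mul, inv_mul_cancel_right₀ hpos.ne']
  have : A * n ≤ A * ((Real.log K - Real.log r) / Real.log 2 + 1) :=
    mul_le_mul_of_nonneg_left hn2.le hA
  calc _ ≤ A * n := by linarith
    _ ≤ _ := this
    _ = _ := by ring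

theorem packingDim_le_of_forall_ae_eventually {μ : Measure (EuclideanSpace ℝ (Fin d))}
    [IsFiniteMeasure μ] {A C K : ℝ} (hA : 0 ≤ A) (hC : 0 ≤ C) (hK : 0 < K)
    (h : ∀ ς > 0, ς < 1 → ∀ᵐ x ∂μ, ∀ᶠ n : ℕ in atTop,
      Real.exp (-((A + C * ς) * n)) ≤ (μ (closedBall x (K * (1 / 2) ^ n))).toReal) :
    packingDim μ ≤ ((A / Real.log 2 : ℝ) : EReal) := by
  have hlim : Tendsto (fun ς : ℝ => (((A + C * ς) / Real.log 2 : ℝ) : EReal))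
      (nhdsWithin 0 (Ioi 0)) (nhds ((A / Real.log 2 : ℝ) : EReal)) := by
    refine (continuous_coe_real_ereal.tendsto _).comp ?_
    have : Continuous fun ς : ℝ => (A + C * ς) / Real.log 2 := by fun_prop
    simpa using (this.tendsto 0).mono_left nhdsWithin_le_nhds
  refine ge_of_tendsto hlim ?_
  filter_upwards [Ioo_mem_nhdsGT one_pos] with ς hς
  refine essSup_le_of_ae_le _ ?_
  filter_upwards [h ς hς.1 hς.2] with x hx
  exact upperLocalDim_le_of_eventually (add_nonneg hA (mul_nonneg hC hς.1.le)) hK hx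

end Dimension

theorem exists_scale {d : ℕ} (hd : 1 ≤ d) {α : ℝ} (hα : 0 < α) (hα' : α ≤ 1 / 2) :
    ∃ m : ℕ, √d * (1 / 2) ^ m < α / 4 ∧ ((1 / 2 : ℝ) ^ d) ^ m ≤ 1 / 8 ∧
      α ^ d / (2 ^ (4 * d) * (d : ℝ) ^ ((d : ℝ) / 2)) ≤ ((1 / 2 : ℝ) ^ d) ^ (m + 1) := by
  have hd1 : (1 : ℝ) ≤ d := by exact_mod_cast hd
  have hs1 : 1 ≤ √(d : ℝ) := Real.one_le_sqrt.2 hd1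
  have hex : ∃ m : ℕ, √d * (1 / 2) ^ m < α / 4 := by
    have h := (tendsto_pow_atTop_nhds_zero_of_lt_one (r := (1 / 2 : ℝ)) (by norm_num)
      (by norm_num)).const_mul √(d : ℝ)
    rw [mul_zero] at h
    exact (h.eventually (gt_mem_nhds (by positivity))).exists
  classical
  have hm := Nat.find_spec hex
  set m := Nat.find hex with hmdef
  have hm0 : m ≠ 0 := fun h => by
    rw [h] at hm
    linarith
  have hm' : α / 8 ≤ √d * (1 / 2) ^ m := by
    obtain ⟨k, hk⟩ := Nat.exists_eq_succ_of_ne_zero hm0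
    have := not_lt.1 (Nat.find_min hex (m := k) (by omega))
    rw [hk, pow_succ]
    linarith
  have h1 : (1 / 2 : ℝ) ^ m ≤ 1 / 8 := by
    have : 1 * (1 / 2 : ℝ) ^ m ≤ √d * (1 / 2) ^ m := by gcongr
    linarith
  refine ⟨m, hm, ?_, ?_⟩
  · rw [← pow_mul, mul_comm, pow_mul]
    exact (pow_le_of_le_one (by positivity) (by linarith) (by omega)).trans h1
  · have e : (d : ℝ) ^ ((d : ℝ) / 2) = √d ^ d := by
      rw [Real.sqrt_eq_rpow, ← Real.rpow_mul_natCast (by positivity)]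
      congr 1
      ring
    rw [e, div_le_iff₀ (by positivity), pow_mul, ← mul_pow, ← pow_mul, mul_comm d, pow_mul,
      ← mul_pow]
    gcongr
    rw [pow_succ]
    linarith

open Classical in
theorem ae_eventually_exp_le_measure_closedBall {d : ℕ} (hd : 1 ≤ d) {α η : ℝ} (hη : 0 < η)
    (hη' : η ≤ 1) {μ : Measure (EuclideanSpace ℝ (Fin d))} [IsProbabilityMeasure μ]
    (hpor : MeanPorous μ α η) {m : ℕ} (hm : √d * (1 / 2) ^ m < α / 4)
    (hqm : ((1 / 2 : ℝ) ^ d) ^ m ≤ 1 / 8) {ς : ℝ} (hς : 0 < ς) (hς1 : ς < 1) :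
    ∀ᵐ x ∂μ, ∀ᶠ n : ℕ in atTop, Real.exp (-((d * Real.log 2 -
      2 / 5 * ((1 / 2) ^ d) ^ (m + 1) * η + 11 * ς) * n)) ≤
        (μ (closedBall x (√d * (1 / 2) ^ n))).toReal := by
  set q : ℝ := (1 / 2) ^ d with hq
  have hq0 : 0 < q := by positivity
  have hq2 : q ≤ 1 / 2 := pow_le_of_le_one (by norm_num) (by norm_num) (by omega)
  set ε := Real.exp (-(1 / ς)) with hε
  set T : ℕ → Set (EuclideanSpace ℝ (Fin d)) := fun i =>
    holeSet μ ε (√d * (1 / 2) ^ (i + m)) ((1 / 2) ^ (i + 2)) with hT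
  have hfreq : ∀ᵐ x ∂μ, ∀ᶠ n : ℕ in atTop, η * (1 - ς) * n - (2 : ℕ) ≤
      ∑ i ∈ Finset.range n, if x ∈ T i then (1 : ℝ) else 0 := by
    filter_upwards [hpor ε (Real.exp_pos _)] with x hx
    refine eventually_sum_ge_of_le_liminf hx (mul_nonneg hη.le (by linarith)) (by nlinarith) 2
      fun i hi => mem_holeSet_of_le_por (by positivity) (by positivity) ?_ (α := α) ?_
    · calc √d * (1 / 2) ^ (i + m) = √d * (1 / 2) ^ m * (1 / 2) ^ i := by ring
        _ < α / 4 * (1 / 2) ^ i := by gcongr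
        _ = α * (1 / 2) ^ (i + 2) := by ring
    · rwa [Real.rpow_neg two_pos.le, Real.rpow_natCast, ← inv_pow, ← one_div] at hi
  obtain ⟨t, ht⟩ := exists_ae_eventually_sum_isDeep_ge μ (S := T)
    (fun j => measurableSet_holeSet μ _ _ _) hς
  set c : ℕ → EuclideanSpace ℝ (Fin d) → Fin d → ℤ := fun n x => cellIdx n (x + t) with hc
  have hcm (n : ℕ) : Measurable (c n) := (measurable_cellIdx n).comp (measurable_add_const t)
  have hcr (n : ℕ) (x y) (h : c (n + 1) x = c (n + 1) y) : c n x = c n y :=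
    cellIdx_eq_of_succ n _ _ h
  have hvol (n : ℕ) (b : Fin d → ℤ) : volume (c n ⁻¹' {b}) = ENNReal.ofReal (q ^ n) := by
    rw [← volume_preimage_cellIdx n b]
    exact (measurePreserving_add_right volume t).measure_preimage
      (measurable_cellIdx n (measurableSet_singleton b)).nullMeasurableSet
  set P : ℕ → Set (Fin d → ℤ) := fun i => {b | ∃ y, c i y = b ∧
    μ (c (i + m) ⁻¹' {c (i + m) y}) ≤ ENNReal.ofReal ε * μ (c i ⁻¹' {b})} with hP
  have hTP (i : ℕ) (x) (hx : x ∈ T i) (hx' : IsDeep i (x + t)) : c i x ∈ P i := by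
    obtain ⟨k, hk1, hk2⟩ := hx
    refine ⟨_, cellIdx_eq_of_isDeep hx' (by rwa [dist_add_right]), ?_⟩
    refine (measure_mono fun z hz => ?_).trans (hk2.trans ?_)
    · rw [mem_closedBall, ← dist_add_right _ _ t]
      exact dist_le_of_cellIdx_eq hz
    · gcongr
      intro z hz
      exact cellIdx_eq_of_isDeep hx' (by rwa [dist_add_right])
  have key := ae_eventually_exp_mul_measure_le (c := c) hcm hcr (μ := μ) (ν := volume)
    (fun x => by rw [hvol]; exact ENNReal.ofReal_ne_top) hq0 hq2
    (fun n x => by rw [hvol, hvol, ← ENNReal.ofReal_mul hq0.le, pow_succ']) hqm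
    (P := P) (H := fun i b => if h : b ∈ P i then c (i + m) h.choose else 0) hς
    (fun i x h => ⟨h.choose, h.choose_spec.1, by rw [dif_pos h]⟩)
    (fun i x h => by rw [dif_pos h]; exact h.choose_spec.2)
  filter_upwards [hfreq, ht, key] with x h1 h2 h3
  have hlarge : ∀ᶠ n : ℕ in atTop, ((m : ℝ) + 2) / ς ≤ n :=
    tendsto_natCast_atTop_atTop.eventually (eventually_ge_atTop _)
  rw [← Filter.map_add_atTop_eq_nat m, eventually_map]
  filter_upwards [h1, h2, h3, (tendsto_add_atTop_nat m).eventually hlarge] with N h1 h2 h3 h4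
  set SP := ∑ i ∈ Finset.range N, if c i x ∈ P i then (1 : ℝ) else 0
  have h5 : ∑ i ∈ Finset.range N, (if x ∈ T i ∧ IsDeep i (x + t) then (1 : ℝ) else 0) ≤ SP := by
    refine Finset.sum_le_sum fun i _ => ?_
    by_cases h : x ∈ T i ∧ IsDeep i (x + t)
    · rw [if_pos h, if_pos (hTP i x h.1 h.2)]
    · rw [if_neg h]
      split_ifs <;> norm_num
  have hqexp : q = Real.exp (-(d * Real.log 2)) := by
    rw [hq, one_div, inv_pow, Real.exp_neg, mul_comm, Real.exp_mul, Real.exp_log two_pos,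
      Real.rpow_natCast]
  rw [hvol, ← ENNReal.ofReal_mul (Real.exp_nonneg _)] at h3
  have h6 : q ^ (N + m) = Real.exp (-(d * Real.log 2) * ((N + m : ℕ) : ℝ)) := by
    rw [mul_comm, Real.exp_nat_mul, ← hqexp]
  rw [h6, ← Real.exp_add] at h3
  have hball : μ (c (N + m) ⁻¹' {c (N + m) x}) ≤ μ (closedBall x (√d * (1 / 2) ^ (N + m))) := by
    refine measure_mono fun z hz => ?_
    rw [mem_closedBall, ← dist_add_right _ _ t]
    exact dist_le_of_cellIdx_eq hz
  refine le_trans (Real.exp_le_exp.2 ?_)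
    ((ENNReal.ofReal_le_iff_le_toReal (measure_ne_top _ _)).1 (h3.trans hball))
  rw [div_le_iff₀ hς] at h4
  set g := 2 / 5 * q ^ m with hg
  have hg0 : 0 ≤ g := by positivity
  have hg1 : g ≤ 1 / 2 := by linarith
  have h7 : q * (η * (1 - ς) * N - 2) - 2 * ς * N ≤ SP := by
    refine le_trans ?_ (h2.trans h5)
    gcongr
    exact_mod_cast h1
  have h8 : g * (q * (η * (1 - ς) * N - 2) - 2 * ς * N) ≤ g * SP := by gcongr
  have hgq : g * q ≤ 1 := by nlinarith
  have hgq0 : 0 ≤ g * q := by positivity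
  have hgqη : g * q * η ≤ 1 := by nlinarith
  have hςN : 0 ≤ ς * N := by positivity
  have hςm : 0 ≤ ς * m := by positivity
  have hm0 : (0 : ℝ) ≤ m := by positivity
  have h9 : g * q * η * (ς * N) ≤ 1 * (ς * N) := by gcongr
  have h10 : g * (ς * N) ≤ 1 / 2 * (ς * N) := by gcongr
  have h11 : g * q * η * m ≤ 1 * m := by gcongr
  rw [show 2 / 5 * q ^ (m + 1) * η = g * q * η by rw [hg]; ring]
  push_cast at h4 ⊢
  linarith

/-- If `μ` is a mean `(α,η)`-porous Borel probability measure on `ℝ^d`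
(`d ≥ 1`, `0 < α ≤ 1/2`, `0 < η ≤ 1`), then
`dim_P(μ) ≤ d − c_d·η·α^d` with `c_d = 2/(5·log 2·2^{4d}·d^{d/2})`. -/
theorem packingDim_le_of_meanPorous (d : ℕ) (hd : 1 ≤ d) (α η : ℝ)
    (hα : 0 < α) (hα' : α ≤ 1 / 2) (hη : 0 < η) (hη' : η ≤ 1)
    (μ : Measure (EuclideanSpace ℝ (Fin d))) [IsProbabilityMeasure μ]
    (hpor : MeanPorous μ α η) :
    packingDim μ ≤
      (((d : ℝ) - 2 / (5 * Real.log 2 * 2 ^ (4 * d) * (d : ℝ) ^ ((d : ℝ) / 2)) * η * α ^ d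
        : ℝ) : EReal) := by
  obtain ⟨m, hm, hqm, hqα⟩ := exists_scale hd hα hα'
  have hd1 : (1 : ℝ) ≤ d := by exact_mod_cast hd
  have hl2 : 0 < Real.log 2 := Real.log_pos one_lt_two
  have hA : 0 ≤ d * Real.log 2 - 2 / 5 * ((1 / 2) ^ d) ^ (m + 1) * η := by
    have h1 : ((1 / 2 : ℝ) ^ d) ^ (m + 1) ≤ 1 :=
      pow_le_one₀ (by positivity) (pow_le_one₀ (by norm_num) (by norm_num))
    have h2 : 2 / 5 * ((1 / 2 : ℝ) ^ d) ^ (m + 1) * η ≤ 2 / 5 * 1 * 1 := by gcongr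
    have h3 : 1 * Real.log 2 ≤ d * Real.log 2 := by gcongr
    linarith [Real.log_two_gt_d9]
  refine (packingDim_le_of_forall_ae_eventually hA (C := 11) (by norm_num)
    (Real.sqrt_pos.2 (by linarith)) fun ς hς hς1 =>
      ae_eventually_exp_le_measure_closedBall hd hη hη' hpor hm hqm hς hς1).trans ?_
  refine EReal.coe_le_coe_iff.2 ?_
  rw [sub_div, mul_div_cancel_right₀ _ hl2.ne']
  refine sub_le_sub_left ?_ _
  rw [le_div_iff₀ hl2]
  calc _ = 2 / 5 * (α ^ d / (2 ^ (4 * d) * (d : ℝ) ^ ((d : ℝ) / 2))) * η := by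
        field_simp
    _ ≤ _ := by gcongr
end

section
/- Let d ≥ 1, 0 < α ≤ 1/2, set k(α) = ⌈log₂(4√d/α)⌉ and t_{d,α}(ε) = 2^{-d}·t_{d,k(α)}(ε). If μ is a mean (α,η,ε)-porous Borel probability measure on ℝ^d with 0 ≤ ε ≤ 2^{-k(α)·d} and 0 < η ≤ 1, then dim_P(μ) ≤ d − η·t_{d,α}(ε). -/
open MeasureTheory Filter Metric Set
open scoped ENNReal NNReal

/-- `s_{d,k}(ε)`: the largest real solution `s` of
`(1−ε)·log((2^d−1)·(Σ_{i=1}^k 2^{-s·i})/(1−ε)) + ε·log(1/ε) = s·ε·log(2^k)`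
(with the convention `0·log 0 = 0`). -/
noncomputable def sdk (d k : ℕ) (ε : ℝ) : ℝ :=
  sSup {s : ℝ |
    (1 - ε) * Real.log (((2 : ℝ) ^ d - 1) *
        (∑ i ∈ Finset.range k, (2 : ℝ) ^ (-(s * ((i : ℝ) + 1)))) / (1 - ε))
      + ε * Real.log (1 / ε) = s * ε * Real.log ((2 : ℝ) ^ k)}

/-- `t_{d,k}(ε) = d − s_{d,k}(ε)`. -/
noncomputable def tdk (d k : ℕ) (ε : ℝ) : ℝ := d - sdk d k ε

/-- `sdk d k ε` lies in `[0, d]` and solves its defining equation. -/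
theorem sdk_spec {d k : ℕ} (hd : 1 ≤ d) (hk : 1 ≤ k) {ε : ℝ} (hε0 : 0 ≤ ε)
    (hε : ε ≤ ((2 : ℝ) ^ (k * d))⁻¹) :
    0 ≤ sdk d k ε ∧ sdk d k ε ≤ d ∧
    (1 - ε) * Real.log (((2 : ℝ) ^ d - 1) *
        (∑ i ∈ Finset.range k, (2 : ℝ) ^ (-(sdk d k ε * ((i : ℝ) + 1)))) / (1 - ε))
      + ε * Real.log (1 / ε) = sdk d k ε * ε * Real.log ((2 : ℝ) ^ k) := by
  have h2d : (2 : ℝ) ≤ 2 ^ d := by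
    calc (2 : ℝ) = 2 ^ 1 := by norm_num
      _ ≤ 2 ^ d := pow_le_pow_right₀ (by norm_num) hd
  have hkd : 1 ≤ k * d := Nat.one_le_iff_ne_zero.2 (by positivity)
  have ha2 : (2 : ℝ) ≤ 2 ^ (k * d) := by
    calc (2 : ℝ) = 2 ^ 1 := by norm_num
      _ ≤ 2 ^ (k * d) := pow_le_pow_right₀ (by norm_num) hkd
  have ha : ((2 : ℝ) ^ (k * d))⁻¹ ≤ 2⁻¹ := by gcongr
  have hε1 : 0 < 1 - ε := by linarith
  have hlogk : 0 ≤ Real.log ((2 : ℝ) ^ k) := Real.log_nonneg (one_le_pow₀ (by norm_num))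
  set A : ℝ → ℝ := fun s => ((2 : ℝ) ^ d - 1) *
    (∑ i ∈ Finset.range k, (2 : ℝ) ^ (-(s * ((i : ℝ) + 1)))) with hA
  have hne : (Finset.range k).Nonempty := ⟨0, Finset.mem_range.2 hk⟩
  have hApos : ∀ s, 0 < A s := fun s =>
    mul_pos (by linarith) (Finset.sum_pos (fun i _ => by positivity) hne)
  have hAanti : StrictAnti A := by
    intro s t hst
    refine mul_lt_mul_of_pos_left (Finset.sum_lt_sum_of_nonempty hne fun i _ => ?_) (by linarith)
    refine Real.rpow_lt_rpow_of_exponent_lt (by norm_num) ?_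
    have : (0 : ℝ) < (i : ℝ) + 1 := by positivity
    nlinarith
  have hAcont : Continuous A := by
    refine continuous_const.mul (continuous_finsetSum _ fun i _ => ?_)
    exact Continuous.rpow continuous_const (by fun_prop) (fun _ => Or.inl (by norm_num))
  set F : ℝ → ℝ := fun s => (1 - ε) * Real.log (A s / (1 - ε)) + ε * Real.log (1 / ε)
    - s * ε * Real.log ((2 : ℝ) ^ k) with hF
  have hFanti : StrictAnti F := by
    intro s t hst
    have h1 : Real.log (A t / (1 - ε)) < Real.log (A s / (1 - ε)) :=
      Real.log_lt_log (div_pos (hApos t) hε1) (by have := hAanti hst; gcongr)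
    have h2 : s * ε * Real.log ((2 : ℝ) ^ k) ≤ t * ε * Real.log ((2 : ℝ) ^ k) := by gcongr
    have h3 := mul_lt_mul_of_pos_left h1 hε1
    simp only [hF]
    linarith
  have hFcont : Continuous F := by
    have h1 : Continuous fun s => Real.log (A s / (1 - ε)) :=
      (hAcont.div_const _).log fun s => (div_pos (hApos s) hε1).ne'
    fun_prop
  have hF0 : 0 ≤ F 0 := by
    have hk1 : (1 : ℝ) ≤ k := by exact_mod_cast hk
    have hA0 : A 0 = (2 ^ d - 1) * k := by simp [hA]
    have h1 : 0 ≤ Real.log (A 0 / (1 - ε)) := by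
      refine Real.log_nonneg ?_
      rw [le_div_iff₀ hε1, hA0]
      nlinarith
    have h2 : 0 ≤ Real.log (1 / ε) := by
      rcases hε0.eq_or_lt with h | h
      · simp [← h]
      · exact Real.log_nonneg (by rw [le_div_iff₀ h]; linarith)
    have := mul_nonneg hε1.le h1
    have := mul_nonneg hε0 h2
    simp only [hF]
    linarith
  have hFd : F d ≤ 0 := by
    set a := ((2 : ℝ) ^ (k * d))⁻¹ with ha'
    have hapos : 0 < a := by positivity
    have hAd : A d = 1 - a := by
      have : ∀ n : ℕ, ((2 : ℝ) ^ d - 1) *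
          (∑ i ∈ Finset.range n, (2 : ℝ) ^ (-((d : ℝ) * ((i : ℝ) + 1)))) =
          1 - ((2 : ℝ) ^ (n * d))⁻¹ := by
        intro n
        induction n with
        | zero => simp
        | succ n ih =>
          rw [Finset.sum_range_succ, mul_add, ih]
          have : (2 : ℝ) ^ (-((d : ℝ) * ((n : ℝ) + 1))) = ((2 : ℝ) ^ ((n + 1) * d))⁻¹ := by
            rw [Real.rpow_neg (by norm_num), ← Real.rpow_natCast]
            push_cast
            ring_nf
          rw [this]
          field_simp
          ring
      exact this k
    have h1 : (1 - ε) * Real.log (A d / (1 - ε)) ≤ ε - a := by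
      have hp : 0 < A d / (1 - ε) := div_pos (hApos d) hε1
      have := mul_le_mul_of_nonneg_left (Real.log_le_sub_one_of_pos hp) hε1.le
      rw [mul_sub, mul_div_cancel₀ _ hε1.ne', hAd] at this
      rw [hAd]
      linarith
    have h2 : ε * Real.log (1 / ε) - d * ε * Real.log ((2 : ℝ) ^ k) ≤ a - ε := by
      rcases hε0.eq_or_lt with h | h
      · simp [← h, hapos.le]
      · have hla : Real.log a = - (d * Real.log ((2 : ℝ) ^ k)) := by
          rw [ha', Real.log_inv, pow_mul, Real.log_pow]
        have := mul_le_mul_of_nonneg_left (Real.log_le_sub_one_of_pos (div_pos hapos h)) hε0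
        rw [mul_sub, mul_div_cancel₀ _ h.ne', Real.log_div hapos.ne' h.ne', hla] at this
        rw [one_div, Real.log_inv]
        linarith
    simp only [hF]
    linarith
  obtain ⟨s, hs, hFs⟩ : ∃ s ∈ Icc (0 : ℝ) d, F s = 0 := by
    have := intermediate_value_Icc' (Nat.cast_nonneg d : (0 : ℝ) ≤ d) hFcont.continuousOn
    exact this ⟨hFd, hF0⟩
  have hset : {s : ℝ | (1 - ε) * Real.log (((2 : ℝ) ^ d - 1) *
        (∑ i ∈ Finset.range k, (2 : ℝ) ^ (-(s * ((i : ℝ) + 1)))) / (1 - ε))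
      + ε * Real.log (1 / ε) = s * ε * Real.log ((2 : ℝ) ^ k)} = {s} := by
    ext t
    simp only [mem_ofPred_eq, mem_singleton_iff]
    rw [← sub_eq_zero]
    exact ⟨fun h => hFanti.injective (h.trans hFs.symm), fun h => h ▸ hFs⟩
  have hsd : sdk d k ε = s := by rw [sdk, hset, csSup_singleton]
  rw [hsd]
  exact ⟨hs.1, hs.2, sub_eq_zero.1 hFs⟩

/-- Bernoulli's inequality in tangent form for the concave power `x ↦ x ^ (1 - θ)`. -/
theorem rpow_one_sub_le_tangent {θ x y : ℝ} (hθ0 : 0 ≤ θ) (hθ1 : θ ≤ 1) (hx : 0 ≤ x)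
    (hy : 0 < y) (c : ℝ) (hc : 0 ≤ c) :
    x ^ (1 - θ) * c ^ θ ≤ (y + (1 - θ) * (x - y)) * (c / y) ^ θ := by
  have h := rpow_one_add_le_one_add_mul_self (s := x / y - 1) (p := 1 - θ)
    (by have := div_nonneg hx hy.le; linarith) (by linarith) (by linarith)
  rw [add_sub_cancel, Real.div_rpow hx hy.le, div_le_iff₀ (by positivity)] at h
  calc x ^ (1 - θ) * c ^ θ
      ≤ ((1 + (1 - θ) * (x / y - 1)) * y ^ (1 - θ)) * c ^ θ := by gcongr
    _ = (y + (1 - θ) * (x - y)) * (c / y) ^ θ := by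
      rw [Real.rpow_sub hy, Real.rpow_one, Real.div_rpow hc hy.le]
      field_simp

/-- If the relative entropy-type quantity `(1-ε) log (A/(1-ε)) + ε log (h/ε)` vanishes, then
the corresponding `θ`-moments are at most `exp (θδ)` for small `θ`, uniformly for `q ≤ ε`. -/
theorem exists_moment_le_exp {A h ε : ℝ} (hA : 0 < A) (hh : 0 < h) (hε0 : 0 ≤ ε) (hε1 : ε < 1)
    (hεh : ε ≤ h)
    (heq : (1 - ε) * Real.log (A / (1 - ε)) + ε * Real.log (h / ε) = 0) {δ : ℝ} (hδ : 0 < δ) :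
    ∃ θ : ℝ, 0 < θ ∧ θ < 1 ∧ ∀ q, 0 ≤ q → q ≤ ε →
      (1 - q) ^ (1 - θ) * A ^ θ + q ^ (1 - θ) * h ^ θ ≤ Real.exp (θ * δ) := by
  have h1ε : 0 < 1 - ε := by linarith
  have hAε := div_pos hA h1ε
  rcases hε0.eq_or_lt with h0 | hεpos
  · subst h0
    refine ⟨1 / 2, by norm_num, by norm_num, fun q hq0 hq1 => ?_⟩
    obtain rfl : q = 0 := le_antisymm hq1 hq0
    have hA1 : A = 1 := by
      have : Real.log A = 0 := by simpa using heq
      exact Real.eq_one_of_pos_of_log_eq_zero hA this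
    rw [hA1, Real.zero_rpow (by norm_num)]
    simpa using hδ.le
  have hhε := div_pos hh hεpos
  have hhε1 : 1 ≤ h / ε := by rwa [le_div_iff₀ hεpos, one_mul]
  have hAε1 : A / (1 - ε) ≤ 1 := by
    have h1 := mul_nonneg hε0 (Real.log_nonneg hhε1)
    have h2 : Real.log (A / (1 - ε)) ≤ 0 := by
      by_contra hcon
      have := mul_pos h1ε (not_le.1 hcon)
      linarith
    exact (Real.log_nonpos_iff hAε.le).1 h2
  have hder : HasDerivAt (fun θ : ℝ => (1 - ε) * (A / (1 - ε)) ^ θ + ε * (h / ε) ^ θ - 1 - θ * δ)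
      (-δ) 0 := by
    have h1 := ((Real.hasStrictDerivAt_const_rpow hAε 0).hasDerivAt).const_mul (1 - ε)
    have h2 := ((Real.hasStrictDerivAt_const_rpow hhε 0).hasDerivAt).const_mul ε
    have h3 := (((h1.add h2).sub_const 1).sub ((hasDerivAt_id (0 : ℝ)).mul_const δ))
    refine h3.congr_deriv ?_
    simp only [Real.rpow_zero, one_mul]
    linarith
  have hev : ∀ᶠ θ in nhdsWithin (0 : ℝ) (Ioi 0),
      (1 - ε) * (A / (1 - ε)) ^ θ + ε * (h / ε) ^ θ - 1 - θ * δ < 0 := by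
    have hs := (hasDerivAt_iff_tendsto_slope.1 hder).mono_left
      (nhdsWithin_mono 0 (fun x (hx : 0 < x) => hx.ne'))
    filter_upwards [hs.eventually (gt_mem_nhds (by linarith : -δ < 0)), self_mem_nhdsWithin]
      with θ hθ hθ0
    have hθ0 : 0 < θ := hθ0
    rw [slope_def_field, div_lt_iff₀ (by linarith)] at hθ
    simp only [Real.rpow_zero] at hθ
    linarith
  obtain ⟨θ, hθ, hθ0, hθ1⟩ := (hev.and (Ioo_mem_nhdsGT (zero_lt_one (α := ℝ)))).exists
  refine ⟨θ, hθ0, hθ1, fun q hq0 hqε => ?_⟩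
  have e1 := rpow_one_sub_le_tangent hθ0.le hθ1.le (x := 1 - q) (by linarith) h1ε A hA.le
  have e2 := rpow_one_sub_le_tangent hθ0.le hθ1.le hq0 hεpos h hh.le
  have e3 : (A / (1 - ε)) ^ θ ≤ (h / ε) ^ θ :=
    Real.rpow_le_rpow hAε.le (hAε1.trans hhε1) hθ0.le
  have e4 : 0 ≤ (1 - θ) * (ε - q) * ((h / ε) ^ θ - (A / (1 - ε)) ^ θ) :=
    mul_nonneg (mul_nonneg (by linarith) (by linarith)) (by linarith)
  have e5 := Real.add_one_le_exp (θ * δ)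
  nlinarith
/-- Hölder's inequality in the form `∑ a^θ x^(1-θ) ≤ (∑ a)^θ (∑ x)^(1-θ)`. -/
theorem sum_rpow_mul_rpow_le {ι : Type*} (S : Finset ι) {a x : ι → ℝ} {θ : ℝ}
    (hθ0 : 0 < θ) (hθ1 : θ < 1) (ha : ∀ i ∈ S, 0 ≤ a i) (hx : ∀ i ∈ S, 0 ≤ x i) :
    ∑ i ∈ S, a i ^ θ * x i ^ (1 - θ) ≤ (∑ i ∈ S, a i) ^ θ * (∑ i ∈ S, x i) ^ (1 - θ) := by
  have h1θ : 0 < 1 - θ := by linarith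
  have hpq : Real.HolderConjugate θ⁻¹ (1 - θ)⁻¹ := by
    rw [Real.holderConjugate_iff]
    exact ⟨(one_lt_inv₀ hθ0).2 hθ1, by rw [inv_inv, inv_inv]; ring⟩
  have h := Real.inner_le_Lp_mul_Lq_of_nonneg S hpq (f := fun i => a i ^ θ)
    (g := fun i => x i ^ (1 - θ)) (fun i hi => Real.rpow_nonneg (ha i hi) _)
    (fun i hi => Real.rpow_nonneg (hx i hi) _)
  rw [Finset.sum_congr rfl fun i hi => Real.rpow_rpow_inv (ha i hi) hθ0.ne',
    Finset.sum_congr rfl fun i hi => Real.rpow_rpow_inv (hx i hi) h1θ.ne'] at h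
  simpa using h

section Tree

variable {T B : Type*} (child : T → B → T)

/-- `TreeDesc child j t w`: the node `w` lies `j` generations below `t`. -/
def TreeDesc : ℕ → T → T → Prop
  | 0, t, w => w = t
  | j + 1, t, w => ∃ b, TreeDesc j (child t b) w

/-- The node `t` has a descendant `k` generations below with at most an `ε`-proportion of
the mass of `t`. -/
def TreePorous (m : T → ℝ) (k : ℕ) (ε : ℝ) (t : T) : Prop :=
  ∃ w, TreeDesc child k t w ∧ m w ≤ ε * m t

open Classical in
/-- The weight of a node: `2^{-s}` at porous nodes, `1/N` at the other ones. -/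
noncomputable def treeWeight (m : T → ℝ) (k N : ℕ) (ε s : ℝ) (t : T) : ℝ :=
  if TreePorous child m k ε t then (2 : ℝ) ^ (-s) else (N : ℝ)⁻¹

/-- The weighted `(1-θ)`-moment sum of the masses of the nodes `j` generations below `t`. -/
noncomputable def treeSum [Fintype B] (m : T → ℝ) (c : T → ℝ) (θ : ℝ) : ℕ → T → ℝ
  | 0, t => m t ^ (1 - θ)
  | j + 1, t => c t ^ θ * ∑ b, treeSum m c θ j (child t b)

/-- `siblingSum N σ i = (N - 1) ∑_{l=1}^i σ^l`. -/
noncomputable def siblingSum (N : ℕ) (σ : ℝ) : ℕ → ℝ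
  | 0 => 0
  | i + 1 => σ * ((N : ℝ) - 1 + siblingSum N σ i)

theorem siblingSum_eq (N : ℕ) (σ : ℝ) (i : ℕ) :
    siblingSum N σ i = ((N : ℝ) - 1) * ∑ l ∈ Finset.range i, σ ^ (l + 1) := by
  induction i with
  | zero => simp [siblingSum]
  | succ i ih =>
    rw [siblingSum, ih, Finset.sum_range_succ']
    simp only [pow_succ σ, ← Finset.sum_mul]
    ring

theorem siblingSum_nonneg {N : ℕ} (hN : 1 ≤ N) {σ : ℝ} (hσ : 0 ≤ σ) (i : ℕ) :
    0 ≤ siblingSum N σ i := by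
  have : (1 : ℝ) ≤ N := by exact_mod_cast hN
  rw [siblingSum_eq]
  exact mul_nonneg (by linarith) (Finset.sum_nonneg fun _ _ => by positivity)

variable [Fintype B] {child} {m : T → ℝ} {c : T → ℝ} {θ : ℝ}

theorem le_of_treeDesc (hm : ∀ t, 0 ≤ m t) (hadd : ∀ t, m t = ∑ b, m (child t b)) :
    ∀ {j : ℕ} {t w : T}, TreeDesc child j t w → m w ≤ m t
  | 0, t, w, h => by rw [show w = t from h]
  | j + 1, t, w, ⟨b, h⟩ => (le_of_treeDesc hm hadd h).trans <| by
      rw [hadd t]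
      exact Finset.single_le_sum (f := fun b => m (child t b)) (fun b _ => hm _)
        (Finset.mem_univ b)

theorem sum_child_rpow_le (hm : ∀ t, 0 ≤ m t) (hadd : ∀ t, m t = ∑ b, m (child t b))
    (hθ0 : 0 < θ) (hθ1 : θ < 1) (t : T) :
    ∑ b, m (child t b) ^ (1 - θ) ≤ (Fintype.card B : ℝ) ^ θ * m t ^ (1 - θ) := by
  have := sum_rpow_mul_rpow_le Finset.univ (a := fun _ : B => (1 : ℝ))
    (x := fun b => m (child t b)) hθ0 hθ1 (fun _ _ => zero_le_one) (fun _ _ => hm _)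
  simpa [← hadd t] using this

theorem treeSum_nonneg (hm : ∀ t, 0 ≤ m t) (hc : ∀ t, 0 ≤ c t) (j : ℕ) (t : T) :
    0 ≤ treeSum child m c θ j t := by
  induction j generalizing t with
  | zero => exact Real.rpow_nonneg (hm t) _
  | succ j ih =>
    exact mul_nonneg (Real.rpow_nonneg (hc t) _) (Finset.sum_nonneg fun b _ => ih _)

theorem treeSum_le_of_le_one (hm : ∀ t, 0 ≤ m t) (hadd : ∀ t, m t = ∑ b, m (child t b))
    (hc : ∀ t, 0 ≤ c t) (hc1 : ∀ t, c t ≤ 1) (hθ0 : 0 < θ) (hθ1 : θ < 1) (j : ℕ) (t : T) :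
    treeSum child m c θ j t ≤ ((Fintype.card B : ℝ) ^ θ) ^ j * m t ^ (1 - θ) := by
  induction j generalizing t with
  | zero => simp [treeSum]
  | succ j ih =>
    calc treeSum child m c θ (j + 1) t
        ≤ 1 * ∑ b, ((Fintype.card B : ℝ) ^ θ) ^ j * m (child t b) ^ (1 - θ) := by
          refine mul_le_mul (Real.rpow_le_one (hc t) (hc1 t) hθ0.le)
            (Finset.sum_le_sum fun b _ => ih _)
            (Finset.sum_nonneg fun b _ => treeSum_nonneg hm hc _ _) zero_le_one
      _ = ((Fintype.card B : ℝ) ^ θ) ^ j * ∑ b, m (child t b) ^ (1 - θ) := by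
          rw [one_mul, Finset.mul_sum]
      _ ≤ ((Fintype.card B : ℝ) ^ θ) ^ j * ((Fintype.card B : ℝ) ^ θ * m t ^ (1 - θ)) := by
          gcongr
          exact sum_child_rpow_le hm hadd hθ0 hθ1 t
      _ = _ := by ring

/-- Moment sums of a node, split along the path to a given descendant `w`. -/
theorem treeSum_le_of_treeDesc (hm : ∀ t, 0 ≤ m t) (hadd : ∀ t, m t = ∑ b, m (child t b))
    (hc : ∀ t, 0 ≤ c t) {σ : ℝ} (hσ : 0 ≤ σ) (hcσ : ∀ t, c t ≤ σ)
    (hθ0 : 0 < θ) (hθ1 : θ < 1) {K : ℝ} (hK : 0 ≤ K) {j : ℕ} :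
    ∀ {i : ℕ} {t w : T}, TreeDesc child i t w →
      (∀ j', j' < j + i ∨ j' = j → ∀ t, treeSum child m c θ j' t ≤ K * m t ^ (1 - θ)) →
      treeSum child m c θ (j + i) t ≤
        K * (siblingSum (Fintype.card B) σ i ^ θ * (m t - m w) ^ (1 - θ)
          + (σ ^ i) ^ θ * m w ^ (1 - θ))
  | 0, t, w, h, hyp => by
      rw [show w = t from h]
      simpa [siblingSum, Real.zero_rpow hθ0.ne'] using hyp j (Or.inr rfl) t
  | i + 1, t, w, ⟨b₀, h⟩, hyp => by
      classical
      have hN : 1 ≤ Fintype.card B := Fintype.card_pos_iff.2 ⟨b₀⟩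
      have hsib := siblingSum_nonneg hN hσ i
      have ih := treeSum_le_of_treeDesc hm hadd hc hσ hcσ hθ0 hθ1 hK (j := j) h
        (fun j' hj' => hyp j' (by omega))
      have hw := le_of_treeDesc hm hadd h
      set a : B → ℝ := fun b => if b = b₀ then siblingSum (Fintype.card B) σ i else 1 with ha
      set x : B → ℝ := fun b => if b = b₀ then m (child t b₀) - m w else m (child t b) with hx
      have hterm : ∀ b, treeSum child m c θ (j + i) (child t b) ≤
          K * (a b ^ θ * x b ^ (1 - θ)) +
            if b = b₀ then K * ((σ ^ i) ^ θ * m w ^ (1 - θ)) else 0 := by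
        intro b
        by_cases hb : b = b₀
        · subst hb
          simp only [ha, hx, if_true]
          rw [← mul_add]
          exact ih
        · simp only [ha, hx, if_neg hb, Real.one_rpow, one_mul, add_zero]
          exact hyp _ (Or.inl (by omega)) _
      have hsuma : ∑ b, a b = (Fintype.card B : ℝ) - 1 + siblingSum (Fintype.card B) σ i := by
        have : ∀ b, a b = 1 + if b = b₀ then siblingSum (Fintype.card B) σ i - 1 else 0 := by
          intro b; simp only [ha]; split_ifs <;> ring
        simp only [this, Finset.sum_add_distrib, Finset.sum_ite_eq', Finset.mem_univ, if_true]
        simp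
        ring
      have hsumx : ∑ b, x b = m t - m w := by
        have : ∀ b, x b = m (child t b) - if b = b₀ then m w else 0 := by
          intro b; simp only [hx]; split_ifs with hb
          · rw [hb]
          · ring
        simp only [this, Finset.sum_sub_distrib, Finset.sum_ite_eq', Finset.mem_univ, if_true]
        rw [← hadd t]
      have hholder := sum_rpow_mul_rpow_le Finset.univ (a := a) (x := x) hθ0 hθ1
        (fun b _ => by simp only [ha]; split_ifs <;> linarith)
        (fun b _ => by simp only [hx]; split_ifs <;> linarith [hm (child t b)])
      rw [hsuma, hsumx] at hholder
      have hN' : (1 : ℝ) ≤ Fintype.card B := by exact_mod_cast hN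
      calc treeSum child m c θ (j + i + 1) t
          ≤ σ ^ θ * ∑ b, treeSum child m c θ (j + i) (child t b) := by
            refine mul_le_mul_of_nonneg_right (Real.rpow_le_rpow (hc t) (hcσ t) hθ0.le) ?_
            exact Finset.sum_nonneg fun b _ => treeSum_nonneg hm hc _ _
        _ ≤ σ ^ θ * (K * ∑ b, a b ^ θ * x b ^ (1 - θ) + K * ((σ ^ i) ^ θ * m w ^ (1 - θ))) := by
            refine mul_le_mul_of_nonneg_left ?_ (by positivity)
            refine (Finset.sum_le_sum fun b _ => hterm b).trans_eq ?_
            rw [Finset.sum_add_distrib, ← Finset.mul_sum]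
            simp
        _ ≤ σ ^ θ * (K * (((Fintype.card B : ℝ) - 1 + siblingSum (Fintype.card B) σ i) ^ θ *
              (m t - m w) ^ (1 - θ)) + K * ((σ ^ i) ^ θ * m w ^ (1 - θ))) := by gcongr
        _ = _ := by
            rw [siblingSum, Real.mul_rpow hσ (by linarith), pow_succ',
              Real.mul_rpow hσ (by positivity)]
            ring

/-- Exponential bound for weighted moment sums of a tree of masses. -/
theorem treeSum_le_exp (hm : ∀ t, 0 ≤ m t) (hadd : ∀ t, m t = ∑ b, m (child t b))
    {k : ℕ} (hk : 1 ≤ k) {ε s κ : ℝ} (hs0 : 0 ≤ s)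
    (hN : 1 ≤ Fintype.card B) (hsN : ((Fintype.card B : ℕ) : ℝ)⁻¹ ≤ (2 : ℝ) ^ (-s))
    (hθ0 : 0 < θ) (hθ1 : θ < 1) (hκ : 0 ≤ κ)
    (hmom : ∀ q, 0 ≤ q → q ≤ ε →
      (1 - q) ^ (1 - θ) * siblingSum (Fintype.card B) ((2 : ℝ) ^ (-s)) k ^ θ
        + q ^ (1 - θ) * (((2 : ℝ) ^ (-s)) ^ k) ^ θ ≤ Real.exp κ) (J : ℕ) (t : T) :
    treeSum child m (treeWeight child m k (Fintype.card B) ε s) θ J t ≤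
      ((Fintype.card B : ℝ) ^ θ) ^ k * Real.exp (κ * J) * m t ^ (1 - θ) := by
  set N := Fintype.card B with hNdef
  set c := treeWeight child m k N ε s with hcdef
  set σ : ℝ := (2 : ℝ) ^ (-s) with hσdef
  have hN' : (1 : ℝ) ≤ N := by exact_mod_cast hN
  have hσ0 : 0 < σ := by positivity
  have hσ1 : σ ≤ 1 := Real.rpow_le_one_of_one_le_of_nonpos (by norm_num) (by linarith)
  have hc0 : ∀ t, 0 ≤ c t := fun t => by
    simp only [hcdef, treeWeight]; split_ifs <;> positivity
  have hcσ : ∀ t, c t ≤ σ := fun t => by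
    simp only [hcdef, treeWeight]
    split_ifs
    exacts [le_rfl, hsN]
  have hNθ : 1 ≤ (N : ℝ) ^ θ := Real.one_le_rpow hN' hθ0.le
  set C : ℝ := ((N : ℝ) ^ θ) ^ k with hC
  have hC1 : 1 ≤ C := one_le_pow₀ hNθ
  induction J using Nat.strong_induction_on generalizing t with
  | _ J ih =>
  have hmt : 0 ≤ m t ^ (1 - θ) := Real.rpow_nonneg (hm t) _
  rcases lt_or_ge J k with hJ | hJ
  · refine (treeSum_le_of_le_one hm hadd hc0 (fun t => (hcσ t).trans hσ1) hθ0 hθ1 J t).trans ?_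
    have h1 : ((N : ℝ) ^ θ) ^ J ≤ C := pow_le_pow_right₀ hNθ hJ.le
    have h2 : 1 ≤ Real.exp (κ * J) := Real.one_le_exp (by positivity)
    gcongr
    nlinarith
  obtain ⟨J, rfl⟩ : ∃ j, J = j + 1 := ⟨J - 1, by omega⟩
  set K := C * Real.exp (κ * J) with hKdef
  have hK : 0 ≤ K := by positivity
  have hKe : C * Real.exp (κ * (J + 1 : ℕ)) = K * Real.exp κ := by
    rw [hKdef, mul_assoc, ← Real.exp_add]; push_cast; ring_nf
  have hle : ∀ j', j' < J + 1 → ∀ t, treeSum child m c θ j' t ≤ K * m t ^ (1 - θ) := by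
    intro j' hj' t
    refine (ih j' hj' t).trans ?_
    have : Real.exp (κ * j') ≤ Real.exp (κ * J) := by
      gcongr
      exact_mod_cast Nat.lt_succ_iff.1 hj'
    exact mul_le_mul_of_nonneg_right (mul_le_mul_of_nonneg_left this (by positivity))
      (Real.rpow_nonneg (hm t) _)
  rw [hKe]
  by_cases hp : TreePorous child m k ε t
  · obtain ⟨w, hw, hmw⟩ := hp
    obtain ⟨j, hj⟩ : ∃ j, J + 1 = j + k := ⟨J + 1 - k, by omega⟩
    have h := treeSum_le_of_treeDesc hm hadd hc0 hσ0.le hcσ hθ0 hθ1 hK (j := j) hw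
      (fun j' hj' => hle j' (by omega))
    rw [hj]
    refine h.trans ?_
    rw [mul_assoc K]
    refine mul_le_mul_of_nonneg_left ?_ hK
    rcases (hm t).eq_or_lt with h0 | hpos
    · have hw0 : m w = 0 := le_antisymm (h0 ▸ le_of_treeDesc hm hadd hw) (hm w)
      have hz : (0 : ℝ) ^ (1 - θ) = 0 := Real.zero_rpow (by linarith)
      rw [← h0, hw0, sub_zero, hz]
      simp
    · have hq := hmom (m w / m t) (div_nonneg (hm w) hpos.le) ((div_le_iff₀ hpos).2 hmw)
      have hle := le_of_treeDesc hm hadd hw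
      have e1 : m t - m w = m t * (1 - m w / m t) := by field_simp
      have e2 : m w ^ (1 - θ) = m t ^ (1 - θ) * (m w / m t) ^ (1 - θ) := by
        rw [← Real.mul_rpow hpos.le (div_nonneg (hm w) hpos.le), mul_div_cancel₀ _ hpos.ne']
      have e3 : 0 ≤ 1 - m w / m t := by rw [sub_nonneg, div_le_one hpos]; exact hle
      rw [e1, e2, Real.mul_rpow hpos.le e3]
      calc _ = m t ^ (1 - θ) * ((1 - m w / m t) ^ (1 - θ) * siblingSum N σ k ^ θ
              + (m w / m t) ^ (1 - θ) * (σ ^ k) ^ θ) := by ring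
        _ ≤ m t ^ (1 - θ) * Real.exp κ := by gcongr
        _ = _ := by ring
  · have hct : c t = (N : ℝ)⁻¹ := by simp only [hcdef, treeWeight, if_neg hp]
    have hNθ0 : (N : ℝ) ^ θ ≠ 0 := by positivity
    calc treeSum child m c θ (J + 1) t
        = ((N : ℝ) ^ θ)⁻¹ * ∑ b, treeSum child m c θ J (child t b) := by
          rw [treeSum, hct, Real.inv_rpow (by positivity)]
      _ ≤ ((N : ℝ) ^ θ)⁻¹ * ∑ b, K * m (child t b) ^ (1 - θ) := by
          gcongr with b
          exact hle J (Nat.lt_succ_self J) _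
      _ ≤ ((N : ℝ) ^ θ)⁻¹ * (K * ((N : ℝ) ^ θ * m t ^ (1 - θ))) := by
          rw [← Finset.mul_sum]
          gcongr
          exact sum_child_rpow_le hm hadd hθ0 hθ1 t
      _ = K * 1 * m t ^ (1 - θ) := by field_simp
      _ ≤ K * Real.exp κ * m t ^ (1 - θ) := by
          gcongr
          exact Real.one_le_exp hκ

end Tree

section Dyadic

variable {d : ℕ}

/-- The child of a dyadic cube, given by its level and integer coordinates, in direction `b`. -/
def dyadicChild (t : ℕ × (Fin d → ℤ)) (b : Fin d → Fin 2) : ℕ × (Fin d → ℤ) :=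
  (t.1 + 1, fun j => 2 * t.2 j + ((b j : ℕ) : ℤ))

/-- The dyadic cube of level `n` containing `x`, for the dyadic grid translated by `-ω`. -/
noncomputable def dyadicNode (ω : Fin d → ℝ) (n : ℕ) (x : EuclideanSpace ℝ (Fin d)) :
    ℕ × (Fin d → ℤ) :=
  (n, fun j => ⌊(2 : ℝ) ^ n * (x j + ω j)⌋)

/-- The set of points of a translated dyadic cube. -/
def dyadicCell (ω : Fin d → ℝ) (t : ℕ × (Fin d → ℤ)) : Set (EuclideanSpace ℝ (Fin d)) :=
  {y | dyadicNode ω t.1 y = t}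

/-- The mass of a translated dyadic cube. -/
noncomputable def dyadicMass (μ : Measure (EuclideanSpace ℝ (Fin d))) (ω : Fin d → ℝ)
    (t : ℕ × (Fin d → ℤ)) : ℝ :=
  μ.real (dyadicCell ω t)

theorem mem_dyadicCell_dyadicNode (ω : Fin d → ℝ) (n : ℕ) (x : EuclideanSpace ℝ (Fin d)) :
    x ∈ dyadicCell ω (dyadicNode ω n x) := rfl

theorem floor_two_mul_ediv_two (v : ℝ) : ⌊2 * v⌋ / 2 = ⌊v⌋ := by
  symm
  rw [Int.floor_eq_iff]
  have h1 := Int.floor_le (2 * v)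
  have h2 := Int.lt_floor_add_one (2 * v)
  have h3 : 2 * (⌊2 * v⌋ / 2) ≤ ⌊2 * v⌋ := by omega
  have h4 : ⌊2 * v⌋ + 1 ≤ 2 * (⌊2 * v⌋ / 2) + 2 := by omega
  have h3' : (2 : ℝ) * ((⌊2 * v⌋ / 2 : ℤ) : ℝ) ≤ ⌊2 * v⌋ := by exact_mod_cast h3
  have h4' : (⌊2 * v⌋ : ℝ) + 1 ≤ 2 * ((⌊2 * v⌋ / 2 : ℤ) : ℝ) + 2 := by exact_mod_cast h4
  constructor <;> linarith

theorem dyadicChild_inj {t t' : ℕ × (Fin d → ℤ)} {b b' : Fin d → Fin 2}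
    (h : dyadicChild t b = dyadicChild t' b') : t = t' ∧ b = b' := by
  have h1 : t.1 = t'.1 := by simpa [dyadicChild] using congrArg Prod.fst h
  have h2 : ∀ j, 2 * t.2 j + ((b j : ℕ) : ℤ) = 2 * t'.2 j + ((b' j : ℕ) : ℤ) :=
    fun j => congrFun (congrArg Prod.snd h) j
  refine ⟨Prod.ext h1 (funext fun j => ?_), funext fun j => Fin.ext ?_⟩ <;>
  · have := h2 j; have := (b j).2; have := (b' j).2; omega

theorem exists_dyadicNode_succ (ω : Fin d → ℝ) (n : ℕ) (x : EuclideanSpace ℝ (Fin d)) :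
    ∃ b, dyadicNode ω (n + 1) x = dyadicChild (dyadicNode ω n x) b := by
  refine ⟨fun j => ⟨(⌊(2 : ℝ) ^ (n + 1) * (x j + ω j)⌋ % 2).toNat, by omega⟩,
    Prod.ext rfl (funext fun j => ?_)⟩
  have h : ⌊(2 : ℝ) ^ (n + 1) * (x j + ω j)⌋ / 2 = ⌊(2 : ℝ) ^ n * (x j + ω j)⌋ := by
    rw [← floor_two_mul_ediv_two ((2 : ℝ) ^ n * (x j + ω j)), pow_succ', mul_assoc]
  simp only [dyadicNode, dyadicChild]
  rw [← h]
  omega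

theorem treeDesc_dyadicNode (ω : Fin d → ℝ) (x : EuclideanSpace ℝ (Fin d)) (k n : ℕ) :
    TreeDesc dyadicChild k (dyadicNode ω n x) (dyadicNode ω (n + k) x) := by
  induction k generalizing n with
  | zero => rfl
  | succ k ih =>
    obtain ⟨b, hb⟩ := exists_dyadicNode_succ ω n x
    refine ⟨b, ?_⟩
    rw [← hb, show n + (k + 1) = n + 1 + k by ring]
    exact ih (n + 1)

theorem measurable_dyadicNode_uncurry (n : ℕ) :
    Measurable fun p : EuclideanSpace ℝ (Fin d) × (Fin d → ℝ) => dyadicNode p.2 n p.1 := by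
  refine measurable_const.prodMk (measurable_pi_iff.2 fun j => ?_)
  exact Int.measurable_floor.comp (by fun_prop)

theorem measurable_dyadicNode (ω : Fin d → ℝ) (n : ℕ) : Measurable (dyadicNode ω n) :=
  (measurable_dyadicNode_uncurry n).comp (measurable_id.prodMk measurable_const)

theorem measurableSet_dyadicCell (ω : Fin d → ℝ) (t : ℕ × (Fin d → ℤ)) :
    MeasurableSet (dyadicCell ω t) :=
  measurable_dyadicNode ω t.1 (measurableSet_singleton t)

theorem mem_dyadicCell_child_iff {ω : Fin d → ℝ} {t : ℕ × (Fin d → ℤ)} {b : Fin d → Fin 2}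
    {x : EuclideanSpace ℝ (Fin d)} :
    x ∈ dyadicCell ω (dyadicChild t b) ↔ x ∈ dyadicCell ω t ∧
      dyadicNode ω (t.1 + 1) x = dyadicChild t b := by
  refine ⟨fun h => ⟨?_, h⟩, fun h => h.2⟩
  obtain ⟨b', hb'⟩ := exists_dyadicNode_succ ω t.1 x
  exact (dyadicChild_inj (hb'.symm.trans h)).1

theorem dyadicCell_eq_iUnion (ω : Fin d → ℝ) (t : ℕ × (Fin d → ℤ)) :
    dyadicCell ω t = ⋃ b ∈ (Finset.univ : Finset (Fin d → Fin 2)),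
      dyadicCell ω (dyadicChild t b) := by
  ext x
  simp only [Finset.mem_univ, mem_iUnion, exists_prop, true_and]
  refine ⟨fun h => ?_, fun ⟨b, hb⟩ => (mem_dyadicCell_child_iff.1 hb).1⟩
  obtain ⟨b, hb⟩ := exists_dyadicNode_succ ω t.1 x
  refine ⟨b, mem_dyadicCell_child_iff.2 ⟨h, ?_⟩⟩
  rw [hb, show dyadicNode ω t.1 x = t from h]

variable (μ : Measure (EuclideanSpace ℝ (Fin d))) [IsProbabilityMeasure μ]

theorem dyadicMass_eq_sum (ω : Fin d → ℝ) (t : ℕ × (Fin d → ℤ)) :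
    dyadicMass μ ω t = ∑ b, dyadicMass μ ω (dyadicChild t b) := by
  rw [dyadicMass, dyadicCell_eq_iUnion, measureReal_biUnion_finset]
  · rfl
  · intro b _ b' _ hbb'
    refine Set.disjoint_left.2 fun x hx hx' => hbb' ?_
    exact (dyadicChild_inj ((mem_dyadicCell_child_iff.1 hx).2.symm.trans
      (mem_dyadicCell_child_iff.1 hx').2)).2
  · exact fun b _ => measurableSet_dyadicCell _ _

/-- Markov-type bound for the set of points whose dyadic cubes have small mass, compared with a
product of weights. -/
theorem measureReal_small_mass_le (ω : Fin d → ℝ) {c : ℕ × (Fin d → ℤ) → ℝ} (hc : ∀ t, 0 < c t)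
    {θ : ℝ} (hθ0 : 0 < θ) (J : ℕ) (t : ℕ × (Fin d → ℤ)) {τ : ℝ} (hτ : 0 < τ) :
    μ.real {x | x ∈ dyadicCell ω t ∧ dyadicMass μ ω (dyadicNode ω (t.1 + J) x) <
        τ * ∏ l ∈ Finset.range J, c (dyadicNode ω (t.1 + l) x)} ≤
      τ ^ θ * treeSum dyadicChild (dyadicMass μ ω) c θ J t := by
  induction J generalizing t τ with
  | zero =>
    simp only [treeSum, Finset.range_zero, Finset.prod_empty, mul_one, add_zero]
    rcases lt_or_ge (dyadicMass μ ω t) τ with h | h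
    · have hm : 0 ≤ dyadicMass μ ω t := measureReal_nonneg
      calc _ ≤ dyadicMass μ ω t := measureReal_mono fun x hx => hx.1
        _ = dyadicMass μ ω t ^ θ * dyadicMass μ ω t ^ (1 - θ) := by
          rw [← Real.rpow_add' hm (by simp), add_sub_cancel, Real.rpow_one]
        _ ≤ _ := by gcongr
    · have : {x | x ∈ dyadicCell ω t ∧ dyadicMass μ ω (dyadicNode ω t.1 x) < τ} = ∅ := by
        ext x
        simp only [mem_ofPred_eq, mem_empty_iff_false, iff_false, not_and, not_lt]
        intro hx
        rwa [show dyadicNode ω t.1 x = t from hx]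
      rw [this, measureReal_empty]
      exact mul_nonneg (by positivity) (Real.rpow_nonneg measureReal_nonneg _)
  | succ J ih =>
    calc _ ≤ μ.real (⋃ b ∈ (Finset.univ : Finset (Fin d → Fin 2)),
            {x | x ∈ dyadicCell ω (dyadicChild t b) ∧
              dyadicMass μ ω (dyadicNode ω ((dyadicChild t b).1 + J) x) <
              (τ * c t) * ∏ l ∈ Finset.range J,
                c (dyadicNode ω ((dyadicChild t b).1 + l) x)}) := by
          refine measureReal_mono (fun x hx => ?_) (measure_ne_top _ _)
          obtain ⟨hxt, hx2⟩ := hx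
          have hxu := hxt
          rw [dyadicCell_eq_iUnion] at hxu
          simp only [Finset.mem_univ, mem_iUnion, exists_prop, true_and] at hxu ⊢
          obtain ⟨b, hb⟩ := hxu
          refine ⟨b, hb, ?_⟩
          rw [Finset.prod_range_succ', add_zero, show dyadicNode ω t.1 x = t from hxt] at hx2
          simp only [dyadicChild]
          convert hx2 using 1
          · congr 2; ring
          · rw [mul_assoc, mul_comm (c t)]
            congr 2
            refine Finset.prod_congr rfl fun l _ => ?_
            congr 2; ring
      _ ≤ ∑ b, (τ * c t) ^ θ * treeSum dyadicChild (dyadicMass μ ω) c θ J (dyadicChild t b) :=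
          (measureReal_biUnion_finset_le _ _).trans
            (Finset.sum_le_sum fun b _ => ih (dyadicChild t b) (mul_pos hτ (hc t)))
      _ = _ := by
          rw [← Finset.mul_sum, Real.mul_rpow hτ.le (hc t).le, treeSum, mul_assoc]

/-- Almost surely the masses of dyadic cubes are eventually bounded below by the product of the
weights along the path, up to a subexponential factor. -/
theorem ae_eventually_prod_weight_le (ω : Fin d → ℝ) {k : ℕ} (hk : 1 ≤ k) {ε s ρ θ κ : ℝ}
    (hs0 : 0 ≤ s) (hsd : s ≤ d) (hθ0 : 0 < θ) (hθ1 : θ < 1) (hκ : 0 ≤ κ) (hκρ : κ < ρ * θ)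
    (hmom : ∀ q, 0 ≤ q → q ≤ ε →
      (1 - q) ^ (1 - θ) * siblingSum (2 ^ d) ((2 : ℝ) ^ (-s)) k ^ θ
        + q ^ (1 - θ) * (((2 : ℝ) ^ (-s)) ^ k) ^ θ ≤ Real.exp κ) :
    ∀ᵐ x ∂μ, ∀ᶠ n : ℕ in atTop, Real.exp (-(ρ * n)) * ∏ l ∈ Finset.range n,
        treeWeight dyadicChild (dyadicMass μ ω) k (2 ^ d) ε s (dyadicNode ω l x) ≤
      dyadicMass μ ω (dyadicNode ω n x) := by
  set c := treeWeight dyadicChild (dyadicMass μ ω) k (2 ^ d) ε s with hc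
  have hcpos : ∀ t, 0 < c t := fun t => by
    simp only [hc, treeWeight]; split_ifs <;> positivity
  have hcard : Fintype.card (Fin d → Fin 2) = 2 ^ d := by simp
  have hsN : (((2 ^ d : ℕ) : ℝ))⁻¹ ≤ (2 : ℝ) ^ (-s) := by
    rw [Real.rpow_neg (by norm_num)]
    push_cast
    rw [← Real.rpow_natCast]
    gcongr
    norm_num
  have hroot : ∀ z : Fin d → ℤ, ∀ᵐ x ∂μ, ∀ᶠ n : ℕ in atTop,
      x ∉ {x | x ∈ dyadicCell ω (0, z) ∧
        dyadicMass μ ω (dyadicNode ω (((0, z) : ℕ × (Fin d → ℤ)).1 + n) x) <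
        Real.exp (-(ρ * n)) * ∏ l ∈ Finset.range n,
          c (dyadicNode ω (((0, z) : ℕ × (Fin d → ℤ)).1 + l) x)} := by
    intro z
    refine ae_eventually_notMem ?_
    set M := ((((2 ^ d : ℕ) : ℝ) ^ θ) ^ k) * dyadicMass μ ω (0, z) ^ (1 - θ) with hM
    have hsum : Summable fun n : ℕ => M * Real.exp (κ - ρ * θ) ^ n :=
      (summable_geometric_of_lt_one (Real.exp_pos _).le
        (Real.exp_lt_one_iff.2 (by linarith))).mul_left M
    refine ne_top_of_le_ne_top hsum.tsum_ofReal_ne_top (ENNReal.tsum_le_tsum fun n => ?_)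
    rw [← ofReal_measureReal]
    refine ENNReal.ofReal_le_ofReal ?_
    refine (measureReal_small_mass_le μ ω hcpos hθ0 n (0, z) (Real.exp_pos _)).trans ?_
    have h := treeSum_le_exp (child := dyadicChild) (m := dyadicMass μ ω) (θ := θ) (k := k)
      (ε := ε) (s := s) (κ := κ) (fun t => measureReal_nonneg) (dyadicMass_eq_sum μ ω) hk hs0
      (by simp only [hcard]; exact Nat.one_le_two_pow) (by simpa only [hcard] using hsN)
      hθ0 hθ1 hκ (by simpa only [hcard] using hmom) n (0, z)
    simp only [hcard] at h
    calc _ ≤ Real.exp (-(ρ * n)) ^ θ * _ := mul_le_mul_of_nonneg_left h (by positivity)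
      _ = M * (Real.exp (-(ρ * n)) ^ θ * Real.exp (κ * n)) := by rw [hM]; ring
      _ = _ := by
        rw [← Real.exp_mul, ← Real.exp_add, ← Real.exp_nat_mul]
        ring_nf
  filter_upwards [ae_all_iff.2 hroot] with x hx
  filter_upwards [hx fun j => ⌊(2 : ℝ) ^ 0 * (x j + ω j)⌋] with n hn
  simp only [not_and, not_lt, zero_add] at hn
  exact hn (mem_dyadicCell_dyadicNode ω 0 x)

end Dyadic

section Porosity

variable {d : ℕ}

/-- The supremum in the definition of porosity is attained, for an open ball. -/
theorem exists_ball_of_le_por (μ : Measure (EuclideanSpace ℝ (Fin d)))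
    {x : EuclideanSpace ℝ (Fin d)} {r ε α : ℝ} (hα : 0 < α) (hr : 0 < r) (h : α ≤ por μ x r ε) :
    ∃ y ∈ closedBall x r, μ (ball y (α * r)) ≤ ENNReal.ofReal ε * μ (closedBall x r) := by
  set S := {α : ℝ | 0 ≤ α ∧ ∃ y, Metric.closedBall y (α * r) ⊆ Metric.closedBall x r ∧
    μ (Metric.closedBall y (α * r)) ≤ ENNReal.ofReal ε * μ (Metric.closedBall x r)} with hS
  have hne : S.Nonempty := by
    by_contra hcon
    rw [not_nonempty_iff_eq_empty] at hcon
    rw [por, ← hS, hcon, Real.sSup_empty] at h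
    linarith
  obtain ⟨u, -, hu, hulim⟩ := exists_seq_strictMono_tendsto α
  have hex : ∀ n, ∃ y ∈ closedBall x r,
      μ (closedBall y (u n * r)) ≤ ENNReal.ofReal ε * μ (closedBall x r) := by
    intro n
    obtain ⟨a, ⟨ha0, y, hy1, hy2⟩, ha⟩ := exists_lt_of_lt_csSup hne ((hu n).trans_le h)
    refine ⟨y, hy1 (mem_closedBall_self (by positivity)), (measure_mono ?_).trans hy2⟩
    exact closedBall_subset_closedBall (by gcongr)
  choose y hy hμy using hex
  obtain ⟨y₀, hy₀, φ, hφ, hlim⟩ := (isCompact_closedBall x r).tendsto_subseq hy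
  refine ⟨y₀, hy₀, ?_⟩
  obtain ⟨v, hvmono, hv, hvlim⟩ := exists_seq_strictMono_tendsto (α * r)
  have hball : ball y₀ (α * r) = ⋃ n, closedBall y₀ (v n) := by
    ext z
    simp only [mem_ball, mem_iUnion, mem_closedBall]
    constructor
    · intro hz
      obtain ⟨n, hn⟩ := (hvlim.eventually (lt_mem_nhds hz)).exists
      exact ⟨n, hn.le⟩
    · rintro ⟨n, hn⟩
      exact hn.trans_lt (hv n)
  have hmono : Monotone fun n => closedBall y₀ (v n) :=
    fun a b hab => closedBall_subset_closedBall (hvmono.monotone hab)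
  rw [hball, hmono.measure_iUnion]
  refine iSup_le fun n => ?_
  have h1 : Tendsto (fun n => u (φ n) * r - dist (y (φ n)) y₀) atTop (nhds (α * r - 0)) :=
    ((hulim.comp hφ.tendsto_atTop).mul_const r).sub (tendsto_iff_dist_tendsto_zero.1 hlim)
  rw [sub_zero] at h1
  obtain ⟨N, hN⟩ := (h1.eventually (lt_mem_nhds (hv n))).exists
  refine (measure_mono ?_).trans (hμy (φ N))
  exact closedBall_subset_closedBall' (by rw [dist_comm]; linarith)

/-- The point `x` lies well inside its translated dyadic cube of level `l`. -/
def IsCentral (ω : Fin d → ℝ) (l : ℕ) (x : EuclideanSpace ℝ (Fin d)) : Prop :=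
  ∀ j, Int.fract ((2 : ℝ) ^ l * (x j + ω j)) ∈ Ico (1 / 4 : ℝ) (3 / 4)

theorem closedBall_subset_dyadicCell {ω : Fin d → ℝ} {l : ℕ} {x : EuclideanSpace ℝ (Fin d)}
    (h : IsCentral ω l x) :
    closedBall x ((2 : ℝ) ^ (l + 2))⁻¹ ⊆ dyadicCell ω (dyadicNode ω l x) := by
  intro z hz
  refine Prod.ext rfl (funext fun j => ?_)
  simp only [dyadicNode]
  have h1 : |z j - x j| ≤ ((2 : ℝ) ^ (l + 2))⁻¹ := by
    have := (PiLp.norm_apply_le (z - x) j).trans (mem_closedBall_iff_norm.1 hz)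
    simpa using this
  have h2 : |(2 : ℝ) ^ l * (z j + ω j) - (2 : ℝ) ^ l * (x j + ω j)| ≤ 1 / 4 := by
    have : (2 : ℝ) ^ l * (z j + ω j) - (2 : ℝ) ^ l * (x j + ω j) =
      (2 : ℝ) ^ l * (z j - x j) := by ring
    rw [this, abs_mul, abs_of_pos (by positivity)]
    calc (2 : ℝ) ^ l * |z j - x j| ≤ (2 : ℝ) ^ l * ((2 : ℝ) ^ (l + 2))⁻¹ := by gcongr
      _ = 1 / 4 := by rw [pow_add]; field_simp; norm_num
  have h3 := h j
  have h4 := Int.floor_add_fract ((2 : ℝ) ^ l * (x j + ω j))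
  rw [abs_le] at h2
  rw [Int.floor_eq_iff]
  constructor <;> linarith [h3.1, h3.2, h2.1, h2.2]

theorem dyadicCell_subset_ball (hd : 1 ≤ d) (ω : Fin d → ℝ) (n : ℕ)
    (y : EuclideanSpace ℝ (Fin d)) :
    dyadicCell ω (dyadicNode ω n y) ⊆ ball y (Real.sqrt d * ((2 : ℝ) ^ n)⁻¹) := by
  intro z hz
  have hne : (Finset.univ : Finset (Fin d)).Nonempty := ⟨⟨0, hd⟩, Finset.mem_univ _⟩
  have hcoord : ∀ j, |z j - y j| < ((2 : ℝ) ^ n)⁻¹ := by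
    intro j
    have h1 : ⌊(2 : ℝ) ^ n * (z j + ω j)⌋ = ⌊(2 : ℝ) ^ n * (y j + ω j)⌋ :=
      congrFun (congrArg Prod.snd (show dyadicNode ω n z = dyadicNode ω n y from hz)) j
    have h2 := Int.abs_sub_lt_one_of_floor_eq_floor h1
    have : (2 : ℝ) ^ n * (z j + ω j) - (2 : ℝ) ^ n * (y j + ω j) =
      (2 : ℝ) ^ n * (z j - y j) := by ring
    rw [this, abs_mul, abs_of_pos (by positivity)] at h2
    rwa [← one_div, lt_div_iff₀' (by positivity)]
  rw [mem_ball, EuclideanSpace.dist_eq]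
  calc Real.sqrt (∑ j, dist (z j) (y j) ^ 2)
      < Real.sqrt (∑ _j : Fin d, (((2 : ℝ) ^ n)⁻¹) ^ 2) := by
        refine Real.sqrt_lt_sqrt (by positivity) (Finset.sum_lt_sum_of_nonempty hne fun j _ => ?_)
        rw [Real.dist_eq]
        exact pow_lt_pow_left₀ (hcoord j) (abs_nonneg _) two_ne_zero
    _ = _ := by
        rw [Finset.sum_const, Finset.card_univ, Fintype.card_fin, nsmul_eq_mul,
          Real.sqrt_mul (by positivity), Real.sqrt_sq (by positivity)]

/-- Porosity at a well-centred point yields porosity of the dyadic cube containing it. -/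
theorem treePorous_of_le_por (hd : 1 ≤ d) (μ : Measure (EuclideanSpace ℝ (Fin d)))
    [IsProbabilityMeasure μ] {ω : Fin d → ℝ} {l k : ℕ} {x : EuclideanSpace ℝ (Fin d)} {α ε : ℝ}
    (hα : 0 < α) (hε : 0 ≤ ε) (hk : 4 * Real.sqrt d / α ≤ (2 : ℝ) ^ k)
    (hx : IsCentral ω l x) (hpor : α ≤ por μ x ((2 : ℝ) ^ (l + 2))⁻¹ ε) :
    TreePorous dyadicChild (dyadicMass μ ω) k ε (dyadicNode ω l x) := by
  obtain ⟨y, hy, hμ⟩ := exists_ball_of_le_por μ hα (by positivity) hpor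
  refine ⟨dyadicNode ω (l + k) y, ?_, ?_⟩
  · rw [← show dyadicNode ω l y = dyadicNode ω l x from closedBall_subset_dyadicCell hx hy]
    exact treeDesc_dyadicNode ω y k l
  · have hsub : dyadicCell ω (dyadicNode ω (l + k) y) ⊆ ball y (α * ((2 : ℝ) ^ (l + 2))⁻¹) := by
      refine (dyadicCell_subset_ball hd ω _ y).trans (ball_subset_ball ?_)
      rw [div_le_iff₀ hα] at hk
      rw [pow_add, pow_add, ← div_eq_mul_inv, ← div_eq_mul_inv, div_le_div_iff₀ (by positivity)
        (by positivity)]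
      have : (0 : ℝ) < 2 ^ l := by positivity
      nlinarith
    have h1 : μ.real (ball y (α * ((2 : ℝ) ^ (l + 2))⁻¹)) ≤
        ε * μ.real (closedBall x ((2 : ℝ) ^ (l + 2))⁻¹) := by
      have := ENNReal.toReal_mono (ENNReal.mul_ne_top ENNReal.ofReal_ne_top (measure_ne_top _ _)) hμ
      rwa [ENNReal.toReal_mul, ENNReal.toReal_ofReal hε] at this
    calc dyadicMass μ ω (dyadicNode ω (l + k) y)
        ≤ μ.real (ball y (α * ((2 : ℝ) ^ (l + 2))⁻¹)) := measureReal_mono hsub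
      _ ≤ _ := h1
      _ ≤ _ := mul_le_mul_of_nonneg_left
          (measureReal_mono (closedBall_subset_dyadicCell hx)) hε

end Porosity

section RandomShift

open ProbabilityTheory

/-- The function equal to `-1` on the central half of each unit interval `[n, n+1)`, and to `1`
elsewhere. -/
noncomputable def centralSign (v : ℝ) : ℝ :=
  1 - 2 * (Ico (1 / 4 : ℝ) (3 / 4)).indicator (fun _ => 1) (Int.fract v)

theorem centralSign_add_nat (v : ℝ) (n : ℕ) : centralSign (v + n) = centralSign v := by
  simp [centralSign]

theorem centralSign_add_half (v : ℝ) : centralSign (v + 1 / 2) = - centralSign v := by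
  have h0 := Int.fract_nonneg v
  have h1 := Int.fract_lt_one v
  have hv := Int.floor_add_fract v
  rcases lt_or_ge (Int.fract v) (1 / 2) with h | h
  · have : Int.fract (v + 1 / 2) = Int.fract v + 1 / 2 := by
      rw [Int.fract_eq_iff]
      exact ⟨by linarith, by linarith, ⌊v⌋, by linarith⟩
    simp only [centralSign, this, indicator, mem_Ico]
    split_ifs <;> grind
  · have : Int.fract (v + 1 / 2) = Int.fract v - 1 / 2 := by
      rw [Int.fract_eq_iff]
      exact ⟨by linarith, by linarith, ⌊v⌋ + 1, by push_cast; linarith⟩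
    simp only [centralSign, this, indicator, mem_Ico]
    split_ifs <;> grind

theorem measurable_centralSign : Measurable centralSign :=
  measurable_const.sub (((measurable_const.indicator measurableSet_Ico).comp
    measurable_fract).const_mul 2)

theorem abs_centralSign_le (v : ℝ) : |centralSign v| ≤ 1 := by
  simp only [centralSign, indicator]
  split_ifs <;> norm_num

theorem integral_eq_zero_of_antiperiodic {f : ℝ → ℝ} {h : ℝ} (hper : ∀ u, f (u + 1) = f u)
    (hanti : ∀ u, f (u + h) = - f u) : ∫ u in (0 : ℝ)..1, f u = 0 := by
  have h1 : ∫ u in (0 : ℝ)..1, f (u + h) = ∫ u in (0 : ℝ)..1, f u := by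
    rw [intervalIntegral.integral_comp_add_right]
    have := Function.Periodic.intervalIntegral_add_eq (f := f) (T := 1) hper (0 + h) 0
    rw [zero_add] at this
    rw [zero_add, add_comm 1 h, this, zero_add]
  simp only [hanti, intervalIntegral.integral_neg] at h1
  linarith

theorem integral_centralSign (a : ℝ) (l : ℕ) :
    ∫ u in (0 : ℝ)..1, centralSign ((2 : ℝ) ^ l * (a + u)) = 0 := by
  refine integral_eq_zero_of_antiperiodic (h := ((2 : ℝ) ^ (l + 1))⁻¹) (fun u => ?_) fun u => ?_
  · rw [← centralSign_add_nat ((2 : ℝ) ^ l * (a + u)) (2 ^ l)]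
    congr 1; push_cast; ring
  · rw [← centralSign_add_half]
    congr 1; rw [pow_succ]; field_simp; ring

theorem integral_centralSign_mul (a : ℝ) {l n : ℕ} (hln : l < n) :
    ∫ u in (0 : ℝ)..1, centralSign ((2 : ℝ) ^ l * (a + u)) * centralSign ((2 : ℝ) ^ n * (a + u))
      = 0 := by
  refine integral_eq_zero_of_antiperiodic (h := ((2 : ℝ) ^ (l + 1))⁻¹) (fun u => ?_) fun u => ?_
  · rw [← centralSign_add_nat ((2 : ℝ) ^ l * (a + u)) (2 ^ l),
      ← centralSign_add_nat ((2 : ℝ) ^ n * (a + u)) (2 ^ n)]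
    congr 2 <;> · push_cast; ring
  · obtain ⟨j, rfl⟩ : ∃ j, n = l + 1 + j := ⟨n - (l + 1), by omega⟩
    rw [← neg_mul, ← centralSign_add_half,
      ← centralSign_add_nat ((2 : ℝ) ^ (l + 1 + j) * (a + u)) (2 ^ j)]
    congr 2
    · rw [pow_succ]; field_simp; ring
    · push_cast; rw [pow_add _ (l + 1)]; field_simp; ring

/-- Translations putting the point `a` of the line in the central half of its dyadic interval. -/
def centralSet (l : ℕ) (a : ℝ) : Set ℝ :=
  {u | Int.fract ((2 : ℝ) ^ l * (a + u)) ∈ Ico (1 / 4 : ℝ) (3 / 4)}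

theorem measurableSet_centralSet (l : ℕ) (a : ℝ) : MeasurableSet (centralSet l a) :=
  (measurable_fract.comp (by fun_prop : Measurable fun u : ℝ => (2 : ℝ) ^ l * (a + u)))
    measurableSet_Ico

theorem indicator_centralSet (l : ℕ) (a u : ℝ) : (centralSet l a).indicator (fun _ => (1 : ℝ)) u =
    (1 - centralSign ((2 : ℝ) ^ l * (a + u))) / 2 := by
  by_cases h : u ∈ centralSet l a
  · have h' : Int.fract ((2 : ℝ) ^ l * (a + u)) ∈ Ico (1 / 4 : ℝ) (3 / 4) := h
    rw [centralSign, indicator_of_mem h, indicator_of_mem h']; norm_num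
  · have h' : Int.fract ((2 : ℝ) ^ l * (a + u)) ∉ Ico (1 / 4 : ℝ) (3 / 4) := h
    rw [centralSign, indicator_of_notMem h, indicator_of_notMem h']; norm_num

theorem intervalIntegrable_of_abs_le_one {f : ℝ → ℝ} (hf : Measurable f) (hf1 : ∀ u, |f u| ≤ 1) :
    IntervalIntegrable f volume 0 1 := by
  rw [intervalIntegrable_iff_integrableOn_Ioc_of_le zero_le_one]
  exact Integrable.of_bound hf.aestronglyMeasurable 1 (ae_of_all _ hf1)

theorem intervalIntegrable_centralSign (l : ℕ) (a : ℝ) :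
    IntervalIntegrable (fun u => centralSign ((2 : ℝ) ^ l * (a + u))) volume 0 1 :=
  intervalIntegrable_of_abs_le_one (measurable_centralSign.comp (by fun_prop))
    fun _ => abs_centralSign_le _

theorem volume_restrict_real_eq {s : Set ℝ} (hs : MeasurableSet s) :
    (volume.restrict (Ioc (0 : ℝ) 1)).real s =
      ∫ u in (0 : ℝ)..1, s.indicator (fun _ => (1 : ℝ)) u := by
  rw [intervalIntegral.integral_of_le zero_le_one, integral_indicator_const _ hs]
  simp

theorem volume_centralSet (l : ℕ) (a : ℝ) :
    volume.restrict (Ioc (0 : ℝ) 1) (centralSet l a) = ENNReal.ofReal (1 / 2) := by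
  rw [← ofReal_measureReal, volume_restrict_real_eq (measurableSet_centralSet l a)]
  congr 1
  simp only [indicator_centralSet]
  rw [intervalIntegral.integral_div, intervalIntegral.integral_sub (by simp)
    (intervalIntegrable_centralSign l a), integral_centralSign]
  simp

theorem volume_centralSet_inter (a : ℝ) {l n : ℕ} (hln : l < n) :
    volume.restrict (Ioc (0 : ℝ) 1) (centralSet l a ∩ centralSet n a) =
      ENNReal.ofReal (1 / 2) * ENNReal.ofReal (1 / 2) := by
  rw [← ofReal_measureReal, volume_restrict_real_eq
    ((measurableSet_centralSet l a).inter (measurableSet_centralSet n a)),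
    ← ENNReal.ofReal_mul (by norm_num)]
  congr 1
  have h : ∀ u, (centralSet l a ∩ centralSet n a).indicator (fun _ => (1 : ℝ)) u =
      (1 - centralSign ((2 : ℝ) ^ l * (a + u)) - (centralSign ((2 : ℝ) ^ n * (a + u)) -
        centralSign ((2 : ℝ) ^ l * (a + u)) * centralSign ((2 : ℝ) ^ n * (a + u)))) / 4 := by
    intro u
    have := Set.inter_indicator_mul (s := centralSet l a) (t := centralSet n a)
      (fun _ => (1 : ℝ)) (fun _ => (1 : ℝ)) u
    simp only [mul_one] at this
    rw [this, indicator_centralSet, indicator_centralSet]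
    ring
  have hint : IntervalIntegrable (fun u => centralSign ((2 : ℝ) ^ l * (a + u)) *
      centralSign ((2 : ℝ) ^ n * (a + u))) volume 0 1 := by
    refine intervalIntegrable_of_abs_le_one ((measurable_centralSign.comp (by fun_prop)).mul
      (measurable_centralSign.comp (by fun_prop))) fun u => ?_
    rw [abs_mul]
    exact mul_le_one₀ (abs_centralSign_le _) (abs_nonneg _) (abs_centralSign_le _)
  have hl := intervalIntegrable_centralSign l a
  have hn := intervalIntegrable_centralSign n a
  simp only [h]
  rw [intervalIntegral.integral_div, intervalIntegral.integral_sub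
    (IntervalIntegrable.sub (by simp) hl) (hn.sub hint), intervalIntegral.integral_sub (by simp) hl,
    intervalIntegral.integral_sub hn hint, integral_centralSign, integral_centralSign,
    integral_centralSign_mul a hln]
  norm_num

theorem indepFun_indicator_one {Ω : Type*} {mΩ : MeasurableSpace Ω} {P : Measure Ω}
    {s t : Set Ω} (h : IndepSet s t P) :
    IndepFun (s.indicator fun _ => (1 : ℝ)) (t.indicator fun _ => (1 : ℝ)) P := by
  rw [IndepFun_iff_Indep]
  rw [IndepSet_iff_Indep] at h
  exact indep_of_indep_of_le_left (indep_of_indep_of_le_right h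
    (MeasurableSpace.comap_indicator_const_le_generateFrom_singleton t 1))
    (MeasurableSpace.comap_indicator_const_le_generateFrom_singleton s 1)

theorem identDistrib_indicator_one {Ω : Type*} {mΩ : MeasurableSpace Ω} {P : Measure Ω}
    [IsProbabilityMeasure P] {s t : Set Ω} (hs : MeasurableSet s) (ht : MeasurableSet t)
    (h : P s = P t) :
    IdentDistrib (s.indicator fun _ => (1 : ℝ)) (t.indicator fun _ => (1 : ℝ)) P P := by
  have hs' : Measurable (s.indicator fun _ => (1 : ℝ)) := measurable_const.indicator hs
  have ht' : Measurable (t.indicator fun _ => (1 : ℝ)) := measurable_const.indicator ht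
  refine ⟨hs'.aemeasurable, ht'.aemeasurable, Measure.ext fun A hA => ?_⟩
  rw [Measure.map_apply hs' hA, Measure.map_apply ht' hA]
  have hc : P sᶜ = P tᶜ := by rw [prob_compl_eq_one_sub hs, prob_compl_eq_one_sub ht, h]
  classical
  rw [indicator_const_preimage_eq_union, indicator_const_preimage_eq_union]
  split_ifs <;> simp [h, hc]

variable {d : ℕ}

/-- The uniform distribution on translations in the unit cube. -/
noncomputable def shiftMeasure (d : ℕ) : Measure (Fin d → ℝ) :=
  Measure.pi fun _ => volume.restrict (Ioc (0 : ℝ) 1)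

instance : IsProbabilityMeasure (volume.restrict (Ioc (0 : ℝ) 1)) :=
  ⟨by simp⟩

instance : IsProbabilityMeasure (shiftMeasure d) := by
  unfold shiftMeasure; infer_instance

theorem setOf_isCentral (l : ℕ) (x : EuclideanSpace ℝ (Fin d)) :
    {ω | IsCentral ω l x} = Set.pi univ fun j => centralSet l (x j) := by
  ext ω
  simp [IsCentral, centralSet]

theorem measurableSet_isCentral (l : ℕ) (x : EuclideanSpace ℝ (Fin d)) :
    MeasurableSet {ω | IsCentral ω l x} := by
  rw [setOf_isCentral]
  exact MeasurableSet.univ_pi fun j => measurableSet_centralSet _ _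

theorem shiftMeasure_isCentral (l : ℕ) (x : EuclideanSpace ℝ (Fin d)) :
    shiftMeasure d {ω | IsCentral ω l x} = ENNReal.ofReal (1 / 2) ^ d := by
  rw [setOf_isCentral, shiftMeasure, Measure.pi_pi]
  simp only [volume_centralSet]
  simp

theorem indepSet_isCentral {l n : ℕ} (hln : l < n) (x : EuclideanSpace ℝ (Fin d)) :
    IndepSet {ω | IsCentral ω l x} {ω | IsCentral ω n x} (shiftMeasure d) := by
  refine (indepSet_iff_measure_inter_eq_mul (measurableSet_isCentral l x)
    (measurableSet_isCentral n x) (shiftMeasure d)).2 ?_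
  rw [shiftMeasure_isCentral, shiftMeasure_isCentral, setOf_isCentral, setOf_isCentral,
    ← Set.pi_inter_distrib, shiftMeasure, Measure.pi_pi]
  simp only [volume_centralSet_inter _ hln]
  simp [mul_pow]

open Classical in
theorem sum_range_count_nth (p : ℕ → Prop) (f : ℕ → ℝ) (n : ℕ) :
    ∑ i ∈ Finset.range (Nat.count p n), f (Nat.nth p i) =
      ∑ l ∈ Finset.range n, if p l then f l else 0 := by
  induction n with
  | zero => simp
  | succ n ih =>
    rw [Finset.sum_range_succ, ← ih, Nat.count_succ]
    split_ifs with h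
    · rw [Finset.sum_range_succ, Nat.nth_count h]
    · simp

open Classical in
/-- Among a set of levels of lower density at least `β`, a proportion `2^{-d}` is central for
almost every translation. -/
theorem ae_eventually_le_sum_isCentral (x : EuclideanSpace ℝ (Fin d)) {p : ℕ → Prop} {β β' : ℝ}
    (hβ : 0 < β) (hβ' : β' < ((2 : ℝ) ^ d)⁻¹ * β)
    (hp : ∀ᶠ n : ℕ in atTop, β * n ≤ (Nat.count p n : ℝ)) :
    ∀ᵐ ω ∂(shiftMeasure d), ∀ᶠ n : ℕ in atTop,
      β' * n ≤ ∑ l ∈ Finset.range n, if p l ∧ IsCentral ω l x then (1 : ℝ) else 0 := by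
  have hcount : Tendsto (fun n => (Nat.count p n : ℝ)) atTop atTop :=
    tendsto_atTop_mono' _ hp (tendsto_natCast_atTop_atTop.const_mul_atTop hβ)
  have hinf : (Set.ofPred p).Infinite := by
    intro hfin
    obtain ⟨n, hn⟩ := (hcount.eventually (eventually_gt_atTop (hfin.toFinset.card : ℝ))).exists
    have h1 : Nat.count p n ≤ hfin.toFinset.card := by
      rw [Nat.count_eq_card_filter_range]
      exact Finset.card_le_card fun i hi => by simpa using (Finset.mem_filter.1 hi).2
    exact absurd hn (not_lt.2 (by exact_mod_cast h1))
  set X : ℕ → (Fin d → ℝ) → ℝ := fun i =>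
    {ω | IsCentral ω (Nat.nth p i) x}.indicator fun _ => (1 : ℝ) with hX
  have hnth := Nat.nth_strictMono hinf
  have hmean : (shiftMeasure d)[X 0] = ((2 : ℝ) ^ d)⁻¹ := by
    simp only [hX]
    rw [integral_indicator_const _ (measurableSet_isCentral _ _), measureReal_def,
      shiftMeasure_isCentral]
    simp
  have hlaw := strong_law_ae_real (μ := shiftMeasure d) X
    ((integrable_const (1 : ℝ)).indicator (measurableSet_isCentral _ _))
    (by
      intro i j hij
      rcases lt_or_gt_of_ne hij with h | h
      · exact indepFun_indicator_one (indepSet_isCentral (hnth h) x)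
      · exact (indepFun_indicator_one (indepSet_isCentral (hnth h) x)).symm)
    (fun i => identDistrib_indicator_one (measurableSet_isCentral _ _)
      (measurableSet_isCentral _ _) (by rw [shiftMeasure_isCentral, shiftMeasure_isCentral]))
  rw [hmean] at hlaw
  filter_upwards [hlaw] with ω hω
  have hcountN : Tendsto (Nat.count p) atTop atTop := tendsto_natCast_atTop_iff.1 hcount
  have h1 := hω.comp hcountN
  have h2 : β' / β < ((2 : ℝ) ^ d)⁻¹ := (div_lt_iff₀ hβ).2 hβ'
  filter_upwards [h1.eventually (lt_mem_nhds h2), hp, hcount.eventually (eventually_gt_atTop 0)]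
    with n hn hpn hn0
  simp only [Function.comp] at hn
  rw [lt_div_iff₀ hn0] at hn
  have h3 : ∑ i ∈ Finset.range (Nat.count p n), X i ω =
      ∑ l ∈ Finset.range n, if p l ∧ IsCentral ω l x then (1 : ℝ) else 0 := by
    rw [sum_range_count_nth p (fun l => {ω | IsCentral ω l x}.indicator (fun _ => (1 : ℝ)) ω)]
    refine Finset.sum_congr rfl fun l _ => ?_
    simp only [indicator, mem_ofPred_eq]
    split_ifs <;> tauto
  rw [← h3]
  rcases le_or_gt β' 0 with h0 | h0
  · refine (mul_nonpos_of_nonpos_of_nonneg h0 (Nat.cast_nonneg n)).trans ?_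
    exact Finset.sum_nonneg fun i _ => indicator_nonneg (fun _ _ => zero_le_one) _
  · refine le_trans ?_ hn.le
    calc β' * n = β' / β * (β * n) := by field_simp
      _ ≤ _ := by gcongr

end RandomShift

section Assembly

open ProbabilityTheory

variable {d : ℕ}

section Measurability

variable (μ : Measure (EuclideanSpace ℝ (Fin d))) [IsProbabilityMeasure μ]

theorem measurable_dyadicMass (t : ℕ × (Fin d → ℤ)) :
    Measurable fun ω : Fin d → ℝ => dyadicMass μ ω t :=
  (measurable_measure_prodMk_right (μ := μ)
    (measurable_dyadicNode_uncurry t.1 (measurableSet_singleton t))).ennreal_toReal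

theorem measurable_treeWeight (k N : ℕ) (ε s : ℝ) (t : ℕ × (Fin d → ℤ)) :
    Measurable fun ω : Fin d → ℝ => treeWeight dyadicChild (dyadicMass μ ω) k N ε s t := by
  unfold treeWeight
  refine Measurable.ite ?_ measurable_const measurable_const
  simp only [TreePorous, ofPred_exists]
  exact MeasurableSet.iUnion fun w => (MeasurableSet.const _).inter
    (measurableSet_le (measurable_dyadicMass μ w) ((measurable_dyadicMass μ t).const_mul ε))

theorem measurable_comp_dyadicNode {g : (Fin d → ℝ) → ℕ × (Fin d → ℤ) → ℝ}
    (hg : ∀ t, Measurable fun ω => g ω t) (n : ℕ) :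
    Measurable fun p : EuclideanSpace ℝ (Fin d) × (Fin d → ℝ) => g p.2 (dyadicNode p.2 n p.1) :=
  (measurable_from_prod_countable_right (f := fun q : (ℕ × (Fin d → ℤ)) × (Fin d → ℝ) => g q.2 q.1)
    hg).comp ((measurable_dyadicNode_uncurry n).prodMk measurable_snd)

theorem measurableSet_eventually_prod_weight_le (k N : ℕ) (ε s ρ : ℝ) :
    MeasurableSet {p : EuclideanSpace ℝ (Fin d) × (Fin d → ℝ) | ∀ᶠ n : ℕ in atTop,
      Real.exp (-(ρ * n)) * ∏ l ∈ Finset.range n,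
        treeWeight dyadicChild (dyadicMass μ p.2) k N ε s (dyadicNode p.2 l p.1) ≤
      dyadicMass μ p.2 (dyadicNode p.2 n p.1)} := by
  simp only [eventually_atTop, ofPred_exists, ofPred_forall]
  refine MeasurableSet.iUnion fun a => MeasurableSet.iInter fun n => MeasurableSet.iInter fun _ =>
    measurableSet_le (measurable_const.mul (Finset.measurable_prod _ fun l _ => ?_)) ?_
  · exact measurable_comp_dyadicNode (measurable_treeWeight μ k N ε s) l
  · exact measurable_comp_dyadicNode (measurable_dyadicMass μ) n

end Measurability

theorem upperLocalDim_le_of_dyadicMass (hd : 1 ≤ d) (μ : Measure (EuclideanSpace ℝ (Fin d)))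
    [IsProbabilityMeasure μ] (ω : Fin d → ℝ) {x : EuclideanSpace ℝ (Fin d)} {c : ℝ} (hc : 0 ≤ c)
    (h : ∀ᶠ n : ℕ in atTop, Real.exp (-(c * n)) ≤ dyadicMass μ ω (dyadicNode ω n x)) :
    upperLocalDim μ x ≤ ((c / Real.log 2 : ℝ) : EReal) := by
  have hlog2 : 0 < Real.log 2 := Real.log_pos one_lt_two
  have hd' : 0 < Real.sqrt d := Real.sqrt_pos.2 (by exact_mod_cast hd)
  have hinv : Tendsto (fun r : ℝ => Real.sqrt d / r) (nhdsWithin 0 (Ioi 0)) atTop :=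
    tendsto_inv_nhdsGT_zero.const_mul_atTop hd'
  have hlevel : Tendsto (fun r : ℝ => ⌈Real.logb 2 (Real.sqrt d / r)⌉₊) (nhdsWithin 0 (Ioi 0))
      atTop := tendsto_nat_ceil_atTop.comp ((Real.tendsto_logb_atTop one_lt_two).comp hinv)
  have hneglog : Tendsto (fun r : ℝ => -Real.log r) (nhdsWithin 0 (Ioi 0)) atTop :=
    tendsto_neg_atBot_atTop.comp Real.tendsto_log_nhdsGT_zero
  set C := c * (Real.log (Real.sqrt d) / Real.log 2 + 1)
  have hlim : Tendsto (fun r : ℝ => c / Real.log 2 + C / (-Real.log r)) (nhdsWithin 0 (Ioi 0))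
      (nhds (c / Real.log 2)) := by
    simpa using (tendsto_const_nhds (x := c / Real.log 2)).add (hneglog.const_div_atTop C)
  have hlim' : Tendsto (fun r : ℝ => ((c / Real.log 2 + C / (-Real.log r) : ℝ) : EReal))
      (nhdsWithin 0 (Ioi 0)) (nhds ((c / Real.log 2 : ℝ) : EReal)) :=
    (continuous_coe_real_ereal.tendsto _).comp hlim
  rw [← hlim'.limsup_eq]
  refine limsup_le_limsup ?_
  filter_upwards [hlevel.eventually h, hneglog.eventually (eventually_gt_atTop 0),
    hinv.eventually (eventually_ge_atTop 1), self_mem_nhdsWithin] with r hr hlogr hdr hr0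
  have hr0 : 0 < r := hr0
  rw [EReal.coe_le_coe_iff]
  set n := ⌈Real.logb 2 (Real.sqrt d / r)⌉₊
  have hle : Real.sqrt d * ((2 : ℝ) ^ n)⁻¹ ≤ r := by
    have h1 : Real.sqrt d / r ≤ (2 : ℝ) ^ (n : ℝ) :=
      (Real.logb_le_iff_le_rpow one_lt_two (by positivity)).1 (Nat.le_ceil _)
    rw [Real.rpow_natCast, div_le_iff₀ hr0] at h1
    rw [← div_eq_mul_inv, div_le_iff₀ (by positivity)]
    linarith
  have hn : (n : ℝ) ≤ Real.log (Real.sqrt d) / Real.log 2 + 1 + (-Real.log r) / Real.log 2 := by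
    have h1 : (n : ℝ) < Real.logb 2 (Real.sqrt d / r) + 1 :=
      Nat.ceil_lt_add_one (Real.logb_nonneg one_lt_two hdr)
    rw [Real.logb, Real.log_div hd'.ne' hr0.ne', sub_div] at h1
    rw [neg_div]
    linarith
  have hmass : Real.exp (-(c * n)) ≤ (μ (closedBall x r)).toReal :=
    hr.trans (measureReal_mono (((dyadicCell_subset_ball hd ω n x).trans
      (ball_subset_ball hle)).trans ball_subset_closedBall))
  have hlogm := (Real.le_log_iff_exp_le ((Real.exp_pos _).trans_le hmass)).2 hmass
  have hcn := mul_le_mul_of_nonneg_left hn hc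
  rw [← neg_div_neg_eq, div_le_iff₀ hlogr, add_mul, div_mul_cancel₀ _ hlogr.ne']
  calc -Real.log (μ (closedBall x r)).toReal ≤ c * n := by linarith
    _ ≤ _ := hcn
    _ = _ := by ring

theorem prod_treeWeight_ge (μ : Measure (EuclideanSpace ℝ (Fin d))) (ω : Fin d → ℝ)
    (x : EuclideanSpace ℝ (Fin d)) {k : ℕ} {ε s : ℝ} (hsd : s ≤ d) {P : ℕ → Prop} [DecidablePred P]
    (hP : ∀ l, P l → TreePorous dyadicChild (dyadicMass μ ω) k ε (dyadicNode ω l x)) (n : ℕ) :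
    Real.exp (Real.log 2 * ((d - s) * (∑ l ∈ Finset.range n, if P l then (1 : ℝ) else 0) - d * n)) ≤
      ∏ l ∈ Finset.range n,
        treeWeight dyadicChild (dyadicMass μ ω) k (2 ^ d) ε s (dyadicNode ω l x) := by
  have h2 : ((2 ^ d : ℕ) : ℝ)⁻¹ = (2 : ℝ) ^ (-(d : ℝ)) := by
    rw [Real.rpow_neg (by norm_num), Real.rpow_natCast]; push_cast; rfl
  have hle : (2 : ℝ) ^ (-(d : ℝ)) ≤ 2 ^ (-s) :=
    Real.rpow_le_rpow_of_exponent_le one_le_two (by linarith)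
  have heq : Real.log 2 * ((d - s) * (∑ l ∈ Finset.range n, if P l then (1 : ℝ) else 0) - d * n) =
      ∑ l ∈ Finset.range n, Real.log 2 * ((d - s) * (if P l then (1 : ℝ) else 0) - d) := by
    rw [← Finset.mul_sum, Finset.sum_sub_distrib, ← Finset.mul_sum]
    simp [mul_comm]
  rw [heq, Real.exp_sum]
  refine Finset.prod_le_prod (fun _ _ => (Real.exp_pos _).le) fun l _ => ?_
  rw [← Real.rpow_def_of_pos two_pos, treeWeight, h2]
  by_cases hl : P l
  · rw [if_pos hl, if_pos (hP l hl)]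
    exact Real.rpow_le_rpow_of_exponent_le one_le_two (by linarith)
  · rw [if_neg hl]
    split_ifs
    · simpa using hle
    · simp

open Classical in
theorem MeanPorousWith.ae_eventually_count {μ : Measure (EuclideanSpace ℝ (Fin d))} {α η ε : ℝ}
    (h : MeanPorousWith μ α η ε) {β : ℝ} (hβ : 0 < β) (hβη : β < η) :
    ∀ᵐ x ∂μ, ∀ᶠ n : ℕ in atTop,
      β * n ≤ (Nat.count (fun l => α ≤ por μ x ((2 : ℝ) ^ (l + 2))⁻¹ ε) n : ℝ) := by
  filter_upwards [h] with x hx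
  obtain ⟨γ, hβγ, hγη⟩ := exists_between hβη
  set P : ℕ → Prop := fun i => α ≤ por μ x ((2 : ℝ) ^ (-(i : ℝ))) ε with hP
  have hcard : ∀ n : ℕ, Set.ncard {i : ℕ | i < n ∧ P i} = Nat.count P n := by
    intro n
    rw [Nat.count_eq_card_filter_range, ← Set.ncard_coe_finset]
    congr 1
    ext i
    simp
  have hev := eventually_lt_of_lt_liminf (hγη.trans_le hx)
    (isBoundedUnder_of ⟨0, fun n => by positivity⟩)
  have hev2 := (tendsto_add_atTop_nat 2).eventually hev
  have hlarge := (tendsto_natCast_atTop_atTop (R := ℝ)).eventually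
    (eventually_ge_atTop (2 / (γ - β)))
  filter_upwards [hev2, hlarge] with n hn hn2
  have hsplit : Nat.count P (n + 2) =
      Nat.count P 2 + Nat.count (fun l => α ≤ por μ x ((2 : ℝ) ^ (l + 2))⁻¹ ε) n := by
    rw [add_comm n 2, Nat.count_add]
    congr 2
    funext l
    simp only [hP]
    rw [Real.rpow_neg (by norm_num), Real.rpow_natCast, add_comm]
  have h2 : Nat.count P 2 ≤ 2 := Nat.count_le P
  rw [lt_div_iff₀ (by positivity), hcard, hsplit] at hn
  rw [div_le_iff₀ (by linarith)] at hn2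
  have h2' : (Nat.count P 2 : ℝ) ≤ 2 := by exact_mod_cast h2
  push_cast at hn
  nlinarith

theorem exists_siblingSum_moment_le {k : ℕ} (hd : 1 ≤ d) (hk : 1 ≤ k) {ε : ℝ} (hε0 : 0 ≤ ε)
    (hε : ε ≤ ((2 : ℝ) ^ (k * d))⁻¹) {δ : ℝ} (hδ : 0 < δ) :
    ∃ θ : ℝ, 0 < θ ∧ θ < 1 ∧ ∀ q, 0 ≤ q → q ≤ ε →
      (1 - q) ^ (1 - θ) * siblingSum (2 ^ d) ((2 : ℝ) ^ (-sdk d k ε)) k ^ θ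
        + q ^ (1 - θ) * (((2 : ℝ) ^ (-sdk d k ε)) ^ k) ^ θ ≤ Real.exp (θ * δ) := by
  obtain ⟨hs0, hsd, heq⟩ := sdk_spec hd hk hε0 hε
  set s := sdk d k ε
  have hkd : 1 ≤ k * d := Nat.mul_pos hk hd
  have hA : siblingSum (2 ^ d) ((2 : ℝ) ^ (-s)) k =
      ((2 : ℝ) ^ d - 1) * ∑ i ∈ Finset.range k, (2 : ℝ) ^ (-(s * ((i : ℝ) + 1))) := by
    rw [siblingSum_eq]
    push_cast
    congr 1
    refine Finset.sum_congr rfl fun i _ => ?_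
    rw [← Real.rpow_natCast, ← Real.rpow_mul (by norm_num)]
    push_cast
    ring_nf
  have hh : ((2 : ℝ) ^ (-s)) ^ k = (2 : ℝ) ^ (-(s * k)) := by
    rw [← Real.rpow_natCast, ← Real.rpow_mul (by norm_num), neg_mul]
  have h2d : (1 : ℝ) < 2 ^ d := one_lt_pow₀ one_lt_two (by omega)
  refine exists_moment_le_exp ?_ (by positivity) hε0 ?_ ?_ ?_ hδ
  · rw [hA]
    refine mul_pos (by linarith) (Finset.sum_pos (fun _ _ => by positivity) ⟨0, ?_⟩)
    exact Finset.mem_range.2 hk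
  · refine hε.trans_lt (inv_lt_one_of_one_lt₀ (one_lt_pow₀ one_lt_two (by omega)))
  · refine hε.trans ?_
    rw [hh, ← Real.rpow_natCast, ← Real.rpow_neg (by norm_num)]
    refine Real.rpow_le_rpow_of_exponent_le one_le_two ?_
    push_cast
    nlinarith [(Nat.cast_nonneg k : (0 : ℝ) ≤ k)]
  · rw [hA]
    rcases hε0.eq_or_lt with h0 | h0
    · rw [← h0] at heq ⊢
      linarith
    · rw [hh, Real.log_div (by positivity) h0.ne', Real.log_rpow two_pos]
      rw [one_div, Real.log_inv, Real.log_pow] at heq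
      linarith

open Classical in
theorem ae_upperLocalDim_le {k : ℕ} (hd : 1 ≤ d) (hk : 1 ≤ k) {α η ε : ℝ} (hα : 0 < α)
    (hη' : η ≤ 1) (hε0 : 0 ≤ ε) (hε : ε ≤ ((2 : ℝ) ^ (k * d))⁻¹)
    (hkα : 4 * Real.sqrt d / α ≤ (2 : ℝ) ^ k)
    (μ : Measure (EuclideanSpace ℝ (Fin d))) [IsProbabilityMeasure μ]
    (hpor : MeanPorousWith μ α η ε) {β β' δ : ℝ} (hβ : 0 < β) (hβη : β < η)
    (hβ' : β' < ((2 : ℝ) ^ d)⁻¹ * β) (hδ : 0 < δ) :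
    ∀ᵐ x ∂μ, upperLocalDim μ x ≤
      (((d - (d - sdk d k ε) * β') + δ / Real.log 2 : ℝ) : EReal) := by
  obtain ⟨hs0, hsd, -⟩ := sdk_spec hd hk hε0 hε
  obtain ⟨θ, hθ0, hθ1, hmom⟩ := exists_siblingSum_moment_le hd hk hε0 hε (half_pos hδ)
  set s := sdk d k ε
  have hlog2 : 0 < Real.log 2 := Real.log_pos one_lt_two
  have hβ1 : β' ≤ 1 := by
    have h2 : ((2 : ℝ) ^ d)⁻¹ ≤ 1 := inv_le_one_of_one_le₀ (one_le_pow₀ one_le_two)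
    nlinarith
  have hmass : ∀ᵐ x ∂μ, ∀ᵐ ω ∂(shiftMeasure d), ∀ᶠ n : ℕ in atTop,
      Real.exp (-(δ * n)) * ∏ l ∈ Finset.range n,
        treeWeight dyadicChild (dyadicMass μ ω) k (2 ^ d) ε s (dyadicNode ω l x) ≤
      dyadicMass μ ω (dyadicNode ω n x) := by
    rw [Measure.ae_ae_comm (measurableSet_eventually_prod_weight_le μ k (2 ^ d) ε s δ)]
    refine ae_of_all _ fun ω => ?_
    exact ae_eventually_prod_weight_le μ ω hk hs0 hsd hθ0 hθ1 (by positivity)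
      (by nlinarith [mul_pos hθ0 hδ]) hmom
  filter_upwards [hmass, hpor.ae_eventually_count hβ hβη] with x hx hcount
  obtain ⟨ω, hω1, hω2⟩ := (hx.and (ae_eventually_le_sum_isCentral x hβ hβ' hcount)).exists
  have hc : 0 ≤ δ + Real.log 2 * (d - (d - s) * β') := by
    have : 0 ≤ (d : ℝ) - (d - s) * β' := by nlinarith
    positivity
  have hdim := upperLocalDim_le_of_dyadicMass hd μ ω (x := x) hc (by
    filter_upwards [hω1, hω2] with n hn1 hn2
    refine le_trans ?_ hn1
    refine le_trans ?_ (mul_le_mul_of_nonneg_left (prod_treeWeight_ge μ ω x hsd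
      (P := fun l => α ≤ por μ x ((2 : ℝ) ^ (l + 2))⁻¹ ε ∧ IsCentral ω l x)
      (fun l hl => treePorous_of_le_por hd μ hα hε0 hkα hl.2 hl.1) n) (Real.exp_pos _).le)
    rw [← Real.exp_add, Real.exp_le_exp]
    have := mul_le_mul_of_nonneg_left
      (mul_le_mul_of_nonneg_left hn2 (sub_nonneg.2 hsd)) hlog2.le
    linarith)
  convert hdim using 2
  field_simp
  ring

end Assembly

/-- Let `d ≥ 1`, `0 < α ≤ 1/2`, `k(α) = ⌈log₂(4√d/α)⌉` and
`t_{d,α}(ε) = 2^{-d}·t_{d,k(α)}(ε)`. If `μ` is a mean `(α,η,ε)`-porous Borel probability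
measure on `ℝ^d` with `0 ≤ ε ≤ 2^{-k(α)·d}` and `0 < η ≤ 1`, then
`dim_P(μ) ≤ d − η·t_{d,α}(ε)`. -/
theorem packingDim_le_of_meanPorousWith (d : ℕ) (hd : 1 ≤ d) (α η ε : ℝ)
    (hα : 0 < α) (hα' : α ≤ 1 / 2) (hη : 0 < η) (hη' : η ≤ 1)
    (hε0 : 0 ≤ ε) (hε : ε ≤ ((2 : ℝ) ^ ((⌈Real.logb 2 (4 * Real.sqrt d / α)⌉₊) * d))⁻¹)
    (μ : Measure (EuclideanSpace ℝ (Fin d))) [IsProbabilityMeasure μ]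
    (hpor : MeanPorousWith μ α η ε) :
    packingDim μ ≤
      (((d : ℝ) - η * (((2 : ℝ) ^ d)⁻¹ * tdk d (⌈Real.logb 2 (4 * Real.sqrt d / α)⌉₊) ε)
        : ℝ) : EReal) := by
  set k := ⌈Real.logb 2 (4 * Real.sqrt d / α)⌉₊
  have hd1 : 1 ≤ Real.sqrt d := Real.one_le_sqrt.2 (by exact_mod_cast hd)
  have hbig : 1 < 4 * Real.sqrt d / α := by
    rw [lt_div_iff₀ hα]
    linarith
  have hk : 1 ≤ k := Nat.one_le_ceil_iff.2 (Real.logb_pos one_lt_two hbig)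
  have hkα : 4 * Real.sqrt d / α ≤ (2 : ℝ) ^ k := by
    rw [← Real.rpow_natCast]
    exact (Real.logb_le_iff_le_rpow one_lt_two (by linarith)).1 (Nat.le_ceil _)
  have hbound : ∀ δ ∈ Ioo 0 η, packingDim μ ≤ ((((d : ℝ) - (d - sdk d k ε) *
      (((2 : ℝ) ^ d)⁻¹ * (η - δ) - δ)) + δ / Real.log 2 : ℝ) : EReal) := fun δ hδ =>
    essSup_le_of_ae_le _ (ae_upperLocalDim_le hd hk hα hη' hε0 hε hkα μ hpor (β := η - δ)
      (by linarith [hδ.2]) (by linarith [hδ.1]) (by linarith [hδ.1]) hδ.1)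
  have hlim : Tendsto (fun δ : ℝ => (((d : ℝ) - (d - sdk d k ε) *
      (((2 : ℝ) ^ d)⁻¹ * (η - δ) - δ)) + δ / Real.log 2)) (nhdsWithin 0 (Ioi 0))
      (nhds ((d : ℝ) - η * (((2 : ℝ) ^ d)⁻¹ * tdk d k ε))) := by
    refine (Continuous.tendsto' (by fun_prop) 0 _ ?_).mono_left nhdsWithin_le_nhds
    simp only [tdk]
    ring
  refine ge_of_tendsto ((continuous_coe_real_ereal.tendsto _).comp hlim) ?_
  filter_upwards [Ioo_mem_nhdsGT hη] with δ hδ using hbound δ hδ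
end
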